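/- arXiv:1411.1620 — 4 statements merged into one kernel-verified Lean document; each statement's English description precedes it below -/
import Mathlib

section
/- For any measurable function f : 𝕋^∞ → ℝ that is L-Lipschitz with respect to the Euclidean metric dist₂ (i.e. |f(x) − f(y)| ≤ L · dist₂(x, y) for all x, y ∈ 𝕋^∞, the condition being vacuous when dist₂(x, y) = +∞), there exists a real number a with the following property: for every ε > 0 there exists a parallel infinite-dimensional subtorus M ⊆ 𝕋^∞ such that the essential supremum of |f − a| over M (with respect to the uniform probability measure on M) is at most ε. -/
noncomputable section
open MeasureTheory ENNReal Filter
open scoped Classical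

/-- The infinite-dimensional torus `𝕋^∞ = (ℝ/ℤ)^ℕ`. -/
abbrev InfTorus : Type := ℕ → AddCircle (1 : ℝ)

/-- The product of the uniform probability measures on the circles `ℝ/ℤ`, realized as the
normalized Haar measure on the compact group `𝕋^∞` (by uniqueness of the translation-invariant
Borel probability measure, they coincide). -/
def torusMeasure : Measure InfTorus :=
  Measure.addHaarMeasure (⊤ : TopologicalSpace.PositiveCompacts InfTorus)

/-- The metric `dist_p` on the infinite torus, valued in `[0,∞]`:
`dist_p(x,y) = (∑ᵢ dist(xᵢ,yᵢ)^p)^(1/p)`. -/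
def distP (p : ℝ) (x y : InfTorus) : ℝ≥0∞ := (∑' i, edist (x i) (y i) ^ p) ^ (1 / p)

/-- The map fixing all coordinates outside `A` to the values of `b`. -/
def subtorusProj (A : Set ℕ) (b : InfTorus) (x : InfTorus) : InfTorus :=
  fun i => if i ∈ A then x i else b i

/-- The uniform probability measure on the parallel subtorus
`M = {x | ∀ i ∉ A, x i = b i}`: the pushforward of the product measure under the projection
onto `M`, i.e. the product of uniform measures over the coordinates in `A`, the remaining
coordinates being fixed to the values of `b`. -/
def subtorusMeasure (A : Set ℕ) (b : InfTorus) : Measure InfTorus :=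
  torusMeasure.map (subtorusProj A b)

open scoped Topology

instance : IsProbabilityMeasure torusMeasure :=
  ⟨Measure.addHaarMeasure_self (K₀ := (⊤ : TopologicalSpace.PositiveCompacts InfTorus))⟩

instance : torusMeasure.IsAddHaarMeasure := by unfold torusMeasure; infer_instance

instance : torusMeasure.Regular := by unfold torusMeasure; infer_instance

theorem continuous_indicator_coords (S : Set ℕ) :
    Continuous fun z : InfTorus => S.indicator z := by
  refine continuous_pi fun i => ?_
  by_cases h : i ∈ S
  · simpa [h] using continuous_apply i
  · simpa [h] using continuous_const

theorem measurable_indicator_coords (S : Set ℕ) :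
    Measurable fun z : InfTorus => S.indicator z :=
  (continuous_indicator_coords S).measurable

theorem measurable_add_indicator_coords (S : Set ℕ) :
    Measurable fun p : InfTorus × InfTorus => p.1 + S.indicator p.2 :=
  measurable_fst.add ((measurable_indicator_coords S).comp measurable_snd)

/-- An almost sure property holds almost surely on almost every parallel subtorus. -/
theorem ae_ae_add_indicator {P : InfTorus → Prop} (hP : ∀ᵐ x ∂torusMeasure, P x) (S : Set ℕ) :
    ∀ᵐ x ∂torusMeasure, ∀ᵐ z ∂torusMeasure, P (x + S.indicator z) := by
  obtain ⟨N, hsub, hN, hN0⟩ := exists_measurable_superset_of_null (ae_iff.1 hP)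
  have key : ∀ᵐ x ∂torusMeasure, ∀ᵐ z ∂torusMeasure, x + S.indicator z ∈ Nᶜ := by
    rw [Measure.ae_ae_comm (p := fun x z : InfTorus => x + S.indicator z ∈ Nᶜ)
      (measurable_add_indicator_coords S hN.compl)]
    refine Eventually.of_forall fun z => ?_
    have h : ∀ᵐ x ∂torusMeasure, x ∈ Nᶜ := measure_eq_zero_iff_ae_notMem.1 hN0
    exact (measurePreserving_add_right torusMeasure (S.indicator z)).quasiMeasurePreserving.ae h
  filter_upwards [key] with x hx
  filter_upwards [hx] with z hz
  by_contra h
  exact hz (hsub h)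

/-- Translations in far-away coordinates are uniformly close to the identity in `L¹`. -/
theorem exists_lintegral_translate_sub_le {F : InfTorus → ℝ} (hF : Integrable F torusMeasure)
    {δ : ℝ≥0∞} (hδ : δ ≠ 0) :
    ∃ N : ℕ, ∀ S : Set ℕ, (∀ i ∈ S, N ≤ i) → ∀ z : InfTorus,
      ∫⁻ x, ‖F (x + S.indicator z) - F x‖ₑ ∂torusMeasure ≤ δ := by
  have hδ3 : δ / 3 ≠ 0 := by simp [ENNReal.div_eq_zero_iff, hδ]
  obtain ⟨g, -, hg, hgc, -⟩ := hF.exists_hasCompactSupport_lintegral_sub_le hδ3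
  obtain ⟨r, hr0, hr⟩ := ENNReal.lt_iff_exists_nnreal_btwn.1 (pos_iff_ne_zero.2 hδ3)
  have hev : ∀ᶠ y in 𝓝 (0 : InfTorus), ∀ x ∈ (Set.univ : Set InfTorus),
      ‖g (x + y) - g x‖ₑ < r := by
    refine isCompact_univ.eventually_forall_of_forall_eventually fun x _ => ?_
    have hc : Continuous fun p : InfTorus × InfTorus => ‖g (p.2 + p.1) - g p.2‖ₑ := by
      fun_prop
    refine hc.continuousAt.eventually_lt continuousAt_const ?_
    simpa using hr0
  rw [nhds_pi] at hev
  obtain ⟨I, t, ht, hI⟩ := Filter.mem_pi'.1 hev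
  refine ⟨I.sup id + 1, fun S hS z => ?_⟩
  have hz : S.indicator z ∈ Set.pi (↑I) t := by
    intro i hi
    have : i ∉ S := fun h => by
      have h1 := hS i h
      have h2 : i ≤ I.sup id := Finset.le_sup (f := id) hi
      omega
    rw [Set.indicator_of_notMem this]
    exact mem_of_mem_nhds (ht i)
  have hsmall := hI hz
  have hmp := measurePreserving_add_right torusMeasure (S.indicator z)
  have htr : ∫⁻ x, ‖F (x + S.indicator z) - g (x + S.indicator z)‖ₑ ∂torusMeasure ≤ δ / 3 := by
    rw [lintegral_add_right_eq_self (fun x => ‖F x - g x‖ₑ) (S.indicator z)]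
    exact hg
  have hd : AEMeasurable (fun x => ‖F x - g x‖ₑ) torusMeasure :=
    (hF.aestronglyMeasurable.sub hgc.aestronglyMeasurable).enorm
  have hd' : AEMeasurable (fun x => ‖F (x + S.indicator z) - g (x + S.indicator z)‖ₑ)
      torusMeasure := hd.comp_quasiMeasurePreserving hmp.quasiMeasurePreserving
  calc ∫⁻ x, ‖F (x + S.indicator z) - F x‖ₑ ∂torusMeasure
      ≤ ∫⁻ x, (‖F (x + S.indicator z) - g (x + S.indicator z)‖ₑ + ‖F x - g x‖ₑ) + r
          ∂torusMeasure := by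
        refine lintegral_mono fun x => ?_
        have h1 : F (x + S.indicator z) - F x = (F (x + S.indicator z) - g (x + S.indicator z))
            - (F x - g x) + (g (x + S.indicator z) - g x) := by ring
        calc ‖F (x + S.indicator z) - F x‖ₑ ≤ _ := by rw [h1]; exact enorm_add_le _ _
          _ ≤ _ := add_le_add enorm_sub_le (hsmall x trivial).le
    _ = (∫⁻ x, ‖F (x + S.indicator z) - g (x + S.indicator z)‖ₑ ∂torusMeasure
          + ∫⁻ x, ‖F x - g x‖ₑ ∂torusMeasure) + r := by
        rw [lintegral_add_right _ measurable_const, lintegral_add_right' _ hd]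
        simp
    _ ≤ δ / 3 + δ / 3 + δ / 3 := by gcongr
    _ = δ := ENNReal.add_thirds δ

/-- The average of `F` over the translates by the subtorus of the coordinates in `S`. -/
def coordAvg (F : InfTorus → ℝ) (S : Set ℕ) (x : InfTorus) : ℝ :=
  ∫ w, F (x + S.indicator w) ∂torusMeasure

theorem measurable_coordAvg {F : InfTorus → ℝ} (hF : Measurable F) (S : Set ℕ) :
    Measurable (coordAvg F S) := by
  have h : StronglyMeasurable
      (Function.uncurry fun x w : InfTorus => F (x + S.indicator w)) :=
    (hF.comp (measurable_add_indicator_coords S)).stronglyMeasurable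
  exact h.integral_prod_right.measurable

theorem integrable_of_measurable_of_bound {F : InfTorus → ℝ} (hF : Measurable F) {K : ℝ}
    (hK : ∀ x, |F x| ≤ K) : Integrable F torusMeasure :=
  Integrable.of_bound hF.aestronglyMeasurable K (Eventually.of_forall hK)

theorem integrable_translate {F : InfTorus → ℝ} (hF : Measurable F) {K : ℝ}
    (hK : ∀ x, |F x| ≤ K) (S : Set ℕ) (x : InfTorus) :
    Integrable (fun w => F (x + S.indicator w)) torusMeasure :=
  integrable_of_measurable_of_bound
    (hF.comp (measurable_const.add (measurable_indicator_coords S))) fun _ => hK _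

theorem lintegral_coordAvg_sub_le {F : InfTorus → ℝ} (hF : Measurable F) {K : ℝ}
    (hK : ∀ x, |F x| ≤ K) {S : Set ℕ} {δ : ℝ≥0∞}
    (h : ∀ z : InfTorus, ∫⁻ x, ‖F (x + S.indicator z) - F x‖ₑ ∂torusMeasure ≤ δ) :
    ∫⁻ x, ‖coordAvg F S x - F x‖ₑ ∂torusMeasure ≤ δ := by
  calc ∫⁻ x, ‖coordAvg F S x - F x‖ₑ ∂torusMeasure
      ≤ ∫⁻ x, ∫⁻ w, ‖F (x + S.indicator w) - F x‖ₑ ∂torusMeasure ∂torusMeasure := by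
        refine lintegral_mono fun x => ?_
        have : coordAvg F S x - F x = ∫ w, (F (x + S.indicator w) - F x) ∂torusMeasure := by
          rw [integral_sub (integrable_translate hF hK S x) (integrable_const _)]
          simp [coordAvg]
        rw [this]
        exact enorm_integral_le_lintegral_enorm _
    _ = ∫⁻ w, ∫⁻ x, ‖F (x + S.indicator w) - F x‖ₑ ∂torusMeasure ∂torusMeasure := by
        refine lintegral_lintegral_swap (Measurable.aemeasurable ?_)
        exact ((hF.comp (measurable_add_indicator_coords S)).sub
          (hF.comp measurable_fst)).enorm
    _ ≤ ∫⁻ _, δ ∂torusMeasure := lintegral_mono fun w => h w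
    _ = δ := by simp

theorem exists_measure_coordAvg_sub_le {F : InfTorus → ℝ} (hF : Measurable F) {K : ℝ}
    (hK : ∀ x, |F x| ≤ K) {γ : ℝ} (hγ : 0 < γ) {κ : ℝ≥0∞} (hκ : κ ≠ 0) :
    ∃ N : ℕ, ∀ S : Set ℕ, (∀ i ∈ S, N ≤ i) →
      torusMeasure {x | γ ≤ |coordAvg F S x - F x|} ≤ κ := by
  have hγ' : ENNReal.ofReal γ ≠ 0 := by simpa using hγ
  obtain ⟨N, hN⟩ := exists_lintegral_translate_sub_le (integrable_of_measurable_of_bound hF hK)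
    (mul_ne_zero hκ hγ')
  refine ⟨N, fun S hS => ?_⟩
  have h := lintegral_coordAvg_sub_le hF hK (hN S hS)
  have hset : {x | γ ≤ |coordAvg F S x - F x|}
      = {x | ENNReal.ofReal γ ≤ ‖coordAvg F S x - F x‖ₑ} := by
    ext x
    simp only [Set.mem_ofPred_eq, Real.enorm_eq_ofReal_abs]
    rw [ENNReal.ofReal_le_ofReal_iff (abs_nonneg _)]
  rw [hset]
  refine (meas_ge_le_lintegral_div ((measurable_coordAvg hF S).sub hF).enorm.aemeasurable hγ'
    ENNReal.ofReal_ne_top).trans ?_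
  exact ENNReal.div_le_of_le_mul h

theorem coordAvg_add_indicator (F : InfTorus → ℝ) {S A : Set ℕ} (hSA : S ⊆ A)
    (x z : InfTorus) :
    coordAvg F S (x + A.indicator z)
      = ∫ w, F (x + S.indicator w + (A \ S).indicator z) ∂torusMeasure := by
  unfold coordAvg
  rw [← integral_add_left_eq_self
    (fun w => F (x + S.indicator w + (A \ S).indicator z)) z]
  refine integral_congr_ae (Eventually.of_forall fun w => ?_)
  refine congrArg F (funext fun i => ?_)
  by_cases hS : i ∈ S
  · simp [hS, hSA hS, add_assoc]
  · by_cases hA : i ∈ A <;> simp [hS, hA]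

theorem ae_abs_coordAvg_translate_sub_le {F : InfTorus → ℝ} (hF : Measurable F) {K : ℝ}
    (hK : ∀ x, |F x| ≤ K) {S A : Set ℕ} (hSA : S ⊆ A) {γ : ℝ} {z : InfTorus}
    (h : ∀ᵐ x ∂torusMeasure, |F (x + (A \ S).indicator z) - F x| ≤ γ) :
    ∀ᵐ x ∂torusMeasure, |coordAvg F S (x + A.indicator z) - coordAvg F S x| ≤ γ := by
  filter_upwards [ae_ae_add_indicator h S] with x hx
  rw [coordAvg_add_indicator F hSA]
  unfold coordAvg
  rw [← integral_sub _ (integrable_translate hF hK S x)]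
  · have hx' : ∀ᵐ w ∂torusMeasure,
        ‖F (x + S.indicator w + (A \ S).indicator z) - F (x + S.indicator w)‖ ≤ γ := hx
    have h1 := norm_integral_le_of_norm_le_const hx'
    rw [probReal_univ, mul_one] at h1
    exact h1
  · exact integrable_of_measurable_of_bound (hF.comp ((measurable_const.add
      (measurable_indicator_coords S)).add measurable_const)) fun _ => hK _

theorem coordAvg_self_add_indicator (F : InfTorus → ℝ) (A : Set ℕ) (x z : InfTorus) :
    coordAvg F A (x + A.indicator z) = coordAvg F A x := by
  rw [coordAvg_add_indicator F subset_rfl]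
  have h0 : (A \ A).indicator z = 0 := by
    rw [sdiff_self]
    exact Set.indicator_empty z
  simp only [h0, add_zero, coordAvg]

theorem measurePreserving_comp_injective {i : ℕ → ℕ} (hi : Function.Injective i) :
    MeasurePreserving (fun z : InfTorus => z ∘ i) torusMeasure torusMeasure := by
  let φ : InfTorus →+ InfTorus :=
    { toFun := fun z => z ∘ i, map_zero' := rfl, map_add' := fun _ _ => rfl }
  have hc : Continuous φ := continuous_pi fun j => continuous_apply (i j)
  have hs : Function.Surjective φ := fun y => 
    ⟨Function.extend i y 0, funext fun j => hi.extend_apply y 0 j⟩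
  exact AddMonoidHom.measurePreserving hc hs rfl

theorem measurable_measure_add_indicator (S : Set ℕ) {E : Set InfTorus}
    (hE : MeasurableSet E) :
    Measurable fun x : InfTorus => torusMeasure {z | x + S.indicator z ∈ E} :=
  measurable_measure_prodMk_left (measurable_add_indicator_coords S hE)

theorem lintegral_measure_add_indicator (S : Set ℕ) {E : Set InfTorus}
    (hE : MeasurableSet E) :
    ∫⁻ x, torusMeasure {z | x + S.indicator z ∈ E} ∂torusMeasure = torusMeasure E := by
  have hm := measurable_add_indicator_coords S hE
  have h1 := Measure.prod_apply (μ := torusMeasure) (ν := torusMeasure) hm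
  have h2 := Measure.prod_apply_symm (μ := torusMeasure) (ν := torusMeasure) hm
  have h3 : ∀ z : InfTorus, torusMeasure {x | x + S.indicator z ∈ E} = torusMeasure E :=
    fun z => (measurePreserving_add_right torusMeasure (S.indicator z)).measure_preimage
      hE.nullMeasurableSet
  have h4 : ∫⁻ z, torusMeasure {x | x + S.indicator z ∈ E} ∂torusMeasure = torusMeasure E := by
    simp [h3]
  exact h1.symm.trans (h2.trans h4)

/-- Uniform continuity with respect to any fixed number of coordinates, up to null sets. -/
def AlmostUnifContinuousCoords (F : InfTorus → ℝ) : Prop :=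
  ∀ (n : ℕ) (γ : ℝ), 0 < γ → ∀ᶠ y in 𝓝 (0 : InfTorus), ∀ i : ℕ → ℕ, Function.Injective i →
    ∀ z : InfTorus, z ∘ i = y →
      ∀ᵐ x ∂torusMeasure, |F (x + (i '' Set.Iio n).indicator z) - F x| ≤ γ

theorem ae_abs_coordAvg_succ_sub_le {F : InfTorus → ℝ} (hF : Measurable F) {K : ℝ}
    (hK : ∀ x, |F x| ≤ K) {i : ℕ → ℕ} (hi : Function.Injective i) {γ : ℝ} {n : ℕ}
    {C : Set InfTorus} (hC : MeasurableSet C)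
    (hCF : ∀ m ∈ Set.Icc n (n + 1), ∀ z : InfTorus, z ∘ i ∈ C →
      ∀ᵐ x ∂torusMeasure, |F (x + (i '' Set.Iio m).indicator z) - F x| ≤ γ)
    {E : Set InfTorus}
    (hE : ∀ m ∈ Set.Icc n (n + 1), ∀ x ∉ E, |coordAvg F (i '' Set.Ici m) x - F x| ≤ γ) :
    ∀ᵐ x ∂torusMeasure,
      torusMeasure {z | x + (Set.range i).indicator z ∈ E} < torusMeasure C →
      |coordAvg F (i '' Set.Ici (n + 1)) x - coordAvg F (i '' Set.Ici n) x| ≤ 4 * γ := by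
  have hmp := measurePreserving_comp_injective hi
  have hstep : ∀ m ∈ Set.Icc n (n + 1), ∀ᵐ x ∂torusMeasure, ∀ᵐ z ∂torusMeasure,
      z ∘ i ∈ C → |coordAvg F (i '' Set.Ici m) (x + (Set.range i).indicator z)
        - coordAvg F (i '' Set.Ici m) x| ≤ γ := by
    intro m hm
    have hAm := measurable_coordAvg hF (i '' Set.Ici m)
    rw [Measure.ae_ae_comm (p := fun x z : InfTorus => z ∘ i ∈ C →
      |coordAvg F (i '' Set.Ici m) (x + (Set.range i).indicator z)
        - coordAvg F (i '' Set.Ici m) x| ≤ γ)]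
    · refine Eventually.of_forall fun z => ?_
      by_cases hz : z ∘ i ∈ C
      · have hd : Set.range i \ i '' Set.Ici m = i '' Set.Iio m := by
          rw [← Set.image_univ, ← Set.image_sdiff hi, ← Set.compl_eq_univ_sdiff, Set.compl_Ici]
        have := ae_abs_coordAvg_translate_sub_le hF hK (Set.image_subset_range i (Set.Ici m))
          (γ := γ) (z := z) (by rw [hd]; exact hCF m hm z hz)
        filter_upwards [this] with x hx _ using hx
      · exact Eventually.of_forall fun x h => absurd h hz
    · have h1 : MeasurableSet {p : InfTorus × InfTorus | p.2 ∘ i ∈ C} :=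
        (hmp.measurable.comp measurable_snd) hC
      have h2 : MeasurableSet {p : InfTorus × InfTorus |
          |coordAvg F (i '' Set.Ici m) (p.1 + (Set.range i).indicator p.2)
            - coordAvg F (i '' Set.Ici m) p.1| ≤ γ} := by
        refine measurableSet_le (Measurable.abs ?_) measurable_const
        exact (hAm.comp (measurable_add_indicator_coords _)).sub (hAm.comp measurable_fst)
      exact h1.imp h2
  filter_upwards [hstep n (by simp), hstep (n + 1) (by simp)] with x hx0 hx1 hlt
  have hfreq : ∃ᶠ z in ae torusMeasure,
      z ∘ i ∈ C ∧ x + (Set.range i).indicator z ∉ E := by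
    intro hcon
    refine absurd hlt (not_lt.2 ?_)
    rw [← hmp.measure_preimage hC.nullMeasurableSet]
    refine measure_mono_ae ?_
    filter_upwards [hcon] with z hz hzC
    by_contra h
    exact hz ⟨hzC, h⟩
  obtain ⟨z, ⟨hzC, hzE⟩, hz0, hz1⟩ := (hfreq.and_eventually (hx0.and hx1)).exists
  have e0 := abs_le.1 (hz0 hzC)
  have e1 := abs_le.1 (hz1 hzC)
  have e2 := abs_le.1 (hE n (by simp) _ hzE)
  have e3 := abs_le.1 (hE (n + 1) (by simp) _ hzE)
  rw [abs_le]
  constructor <;> linarith [e0.1, e0.2, e1.1, e1.2, e2.1, e2.2, e3.1, e3.2]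

theorem exists_infinite_ae_abs_sub_le {F : InfTorus → ℝ} (hF : Measurable F) {K : ℝ}
    (hK : ∀ x, |F x| ≤ K) (hFc : AlmostUnifContinuousCoords F) {ε : ℝ} (hε : 0 < ε) :
    ∃ (A : Set ℕ) (W : Set InfTorus), A.Infinite ∧ torusMeasure Wᶜ ≤ 1 / 4 ∧
      ∀ᵐ b ∂torusMeasure, b ∈ W →
        ∀ᵐ z ∂torusMeasure, |F (b + A.indicator z) - F b| ≤ ε := by
  obtain ⟨γ, hγ, c, hγc, hcε⟩ := posSumOfEncodable (show 0 < ε / 10 by positivity) ℕ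
  have hCex : ∀ n, ∃ C : Set InfTorus, IsOpen C ∧ 0 ∈ C ∧ ∀ m ∈ Set.Icc n (n + 1),
      ∀ i : ℕ → ℕ, Function.Injective i → ∀ z : InfTorus, z ∘ i ∈ C →
        ∀ᵐ x ∂torusMeasure, |F (x + (i '' Set.Iio m).indicator z) - F x| ≤ γ n := by
    intro n
    obtain ⟨C, hC, hCo, hC0⟩ :=
      eventually_nhds_iff.1 ((hFc n (γ n) (hγ n)).and (hFc (n + 1) (γ n) (hγ n)))
    refine ⟨C, hCo, hC0, fun m hm i hi z hz => ?_⟩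
    have hm' : m = n ∨ m = n + 1 := by
      have := hm.1
      have := hm.2
      omega
    rcases hm' with rfl | rfl
    · exact (hC _ hz).1 i hi z rfl
    · exact (hC _ hz).2 i hi z rfl
  choose C hCo hC0 hCF using hCex
  have hβ : ∀ n, torusMeasure (C n) ≠ 0 := fun n => ((hCo n).measure_pos _ ⟨0, hC0 n⟩).ne'
  obtain ⟨κ, hκ, hκsum⟩ := ENNReal.exists_pos_sum_of_countable (ε := 1 / 4) (by simp) ℕ
  have hκ2 : ∀ n, torusMeasure (C n) * κ n / 2 ≠ 0 := fun n => by
    simp [ENNReal.div_eq_zero_iff, hβ n, (hκ n).ne']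
  obtain ⟨i, hi, hiS⟩ := Filter.extraction_forall_of_eventually'
    (P := fun n k => ∀ S : Set ℕ, (∀ j ∈ S, k ≤ j) →
      torusMeasure {x | γ n ≤ |coordAvg F S x - F x|} ≤ torusMeasure (C n) * κ n / 2)
    (fun n => by
      obtain ⟨N, hN⟩ := exists_measure_coordAvg_sub_le hF hK (hγ n) (hκ2 n)
      exact ⟨N, fun k hk S hS => hN S fun j hj => hk.trans (hS j hj)⟩)
  set D : ℕ → ℕ → Set InfTorus :=
    fun n m => {x | γ n ≤ |coordAvg F (i '' Set.Ici m) x - F x|} with hD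
  have hDm : ∀ n m, MeasurableSet (D n m) := fun n m =>
    measurableSet_le measurable_const ((measurable_coordAvg hF _).sub hF).abs
  set E : ℕ → Set InfTorus := fun n => D n n ∪ D n (n + 1) with hEdef
  have hEm : ∀ n, MeasurableSet (E n) := fun n => (hDm _ _).union (hDm _ _)
  have hEle : ∀ n, torusMeasure (E n) ≤ torusMeasure (C n) * κ n := by
    intro n
    have hle : ∀ m, n ≤ m → torusMeasure (D n m) ≤ torusMeasure (C n) * κ n / 2 := by
      refine fun m hm => hiS n _ ?_
      rintro _ ⟨j, hj, rfl⟩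
      exact hi.monotone (hm.trans hj)
    calc torusMeasure (E n) ≤ _ := measure_union_le _ _
      _ ≤ _ := add_le_add (hle n le_rfl) (hle (n + 1) (Nat.le_succ n))
      _ = _ := ENNReal.add_halves _
  have hnotE : ∀ n, ∀ m ∈ Set.Icc n (n + 1), ∀ x ∉ E n,
      |coordAvg F (i '' Set.Ici m) x - F x| ≤ γ n := by
    intro n m hm x hx
    have hm' : m = n ∨ m = n + 1 := by
      have := hm.1
      have := hm.2
      omega
    by_contra! hcon
    rcases hm' with rfl | rfl
    · exact hx (Or.inl hcon.le)
    · exact hx (Or.inr hcon.le)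
  set A : Set ℕ := Set.range i with hA
  have hAS : i '' Set.Ici 0 = A := by
    rw [hA, ← Set.image_univ]
    congr 1
    ext k
    simp
  set W : Set InfTorus := {x | ∀ n, torusMeasure {z | x + A.indicator z ∈ E n}
    < torusMeasure (C n)} with hW
  have hWinv : ∀ x ∈ W, ∀ z : InfTorus, x + A.indicator z ∈ W := by
    intro x hx z n
    refine lt_of_eq_of_lt ?_ (hx n)
    have hset : {w : InfTorus | x + A.indicator z + A.indicator w ∈ E n}
        = (fun w => z + w) ⁻¹' {w | x + A.indicator w ∈ E n} := by
      ext w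
      have : A.indicator (z + w) = A.indicator z + A.indicator w := Set.indicator_add' A z w
      simp [this, add_assoc]
    rw [hset, measure_preimage_add]
  have hWc : torusMeasure Wᶜ ≤ 1 / 4 := by
    have hsub : Wᶜ ⊆ ⋃ n, {x | torusMeasure (C n)
        ≤ torusMeasure {z | x + A.indicator z ∈ E n}} := by
      intro x hx
      by_contra hcon
      refine hx fun n => ?_
      by_contra hn
      exact hcon (Set.mem_iUnion.2 ⟨n, not_lt.1 hn⟩)
    calc torusMeasure Wᶜ ≤ _ := measure_mono hsub
      _ ≤ ∑' n, _ := measure_iUnion_le _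
      _ ≤ ∑' n, (κ n : ℝ≥0∞) := by
        refine ENNReal.tsum_le_tsum fun n => ?_
        refine (meas_ge_le_lintegral_div
          (measurable_measure_add_indicator A (hEm n)).aemeasurable (hβ n)
          (measure_ne_top _ _)).trans ?_
        rw [lintegral_measure_add_indicator A (hEm n)]
        refine ENNReal.div_le_of_le_mul ?_
        rw [mul_comm]
        exact hEle n
      _ ≤ 1 / 4 := hκsum.le
  have hBC : ∀ᵐ x ∂torusMeasure, ∀ᶠ n in atTop, x ∉ E n := by
    refine ae_eventually_notMem (ne_top_of_le_ne_top (b := ∑' n, (κ n : ℝ≥0∞)) ?_ ?_)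
    · exact (hκsum.trans (by simp)).ne
    · refine ENNReal.tsum_le_tsum fun n => (hEle n).trans ?_
      exact mul_le_of_le_one_left' prob_le_one
  have hu : ∀ᵐ x ∂torusMeasure, ∀ n,
      torusMeasure {z | x + A.indicator z ∈ E n} < torusMeasure (C n) →
      |coordAvg F (i '' Set.Ici (n + 1)) x - coordAvg F (i '' Set.Ici n) x| ≤ 4 * γ n :=
    ae_all_iff.2 fun n => ae_abs_coordAvg_succ_sub_le hF hK hi.injective
      (hCo n).measurableSet (fun m hm z hz => hCF n m hm i hi.injective z hz) (hnotE n)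
  have hgood : ∀ᵐ x ∂torusMeasure, x ∈ W → |F x - coordAvg F A x| ≤ ε / 2 := by
    filter_upwards [hBC, hu] with x hx hux hxW
    have hsum : ∀ n, |coordAvg F (i '' Set.Ici n) x - coordAvg F A x|
        ≤ 4 * ∑ k ∈ Finset.range n, γ k := by
      intro n
      induction n with
      | zero => rw [hAS]; simp
      | succ n ih =>
        rw [Finset.sum_range_succ]
        have h1 := hux n (hxW n)
        have h2 := abs_sub_le (coordAvg F (i '' Set.Ici (n + 1)) x)
          (coordAvg F (i '' Set.Ici n) x) (coordAvg F A x)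
        linarith
    obtain ⟨n, hn⟩ := hx.exists
    have h1 := hnotE n n (by simp) x hn
    have h2 := hsum n
    have h3 : ∑ k ∈ Finset.range n, γ k ≤ c :=
      sum_le_hasSum _ (fun k _ => (hγ k).le) hγc
    have h4 : γ n ≤ c := le_hasSum hγc n fun k _ => (hγ k).le
    rw [abs_sub_comm] at h1
    have h5 := abs_sub_le (F x) (coordAvg F (i '' Set.Ici n) x) (coordAvg F A x)
    linarith
  refine ⟨A, W, Set.infinite_range_of_injective hi.injective, hWc, ?_⟩
  filter_upwards [hgood, ae_ae_add_indicator hgood A] with b hb hbz hbW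
  filter_upwards [hbz] with z hz
  have h1 := hz (hWinv b hbW z)
  rw [coordAvg_self_add_indicator] at h1
  have h2 := hb hbW
  rw [abs_sub_comm] at h2
  have h3 := abs_sub_le (F (b + A.indicator z)) (coordAvg F A b) (F b)
  linarith

theorem subtorusMeasure_eq_map_add_indicator (A : Set ℕ) (b : InfTorus) :
    subtorusMeasure A b = torusMeasure.map fun z => b + A.indicator z := by
  have hm : Measurable fun z : InfTorus => b + A.indicator z :=
    measurable_const.add (measurable_indicator_coords A)
  have hmp := measurePreserving_add_right torusMeasure (-b)
  have hcomp : subtorusProj A b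
      = (fun z : InfTorus => b + A.indicator z) ∘ fun x : InfTorus => x + -b := by
    funext x i
    by_cases h : i ∈ A <;> simp [subtorusProj, h]
  rw [subtorusMeasure, hcomp, ← Measure.map_map hm hmp.measurable, hmp.map_eq]

theorem distP_two_add_indicator_image {i : ℕ → ℕ} (hi : Function.Injective i) (n : ℕ)
    (x z : InfTorus) :
    distP 2 (x + (i '' Set.Iio n).indicator z) x
      = (∑ k ∈ Finset.range n, edist ((z ∘ i) k) 0 ^ (2 : ℝ)) ^ (1 / 2 : ℝ) := by
  have hterm : ∀ j, edist ((x + (i '' Set.Iio n).indicator z) j) (x j)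
      = edist ((i '' Set.Iio n).indicator z j) 0 := by
    intro j
    simpa using edist_add_left (x j) ((i '' Set.Iio n).indicator z j) 0
  unfold distP
  congr 1
  rw [tsum_eq_sum (s := (Finset.range n).image i), Finset.sum_image hi.injOn]
  · refine Finset.sum_congr rfl fun k hk => ?_
    have hk' : i k ∈ i '' Set.Iio n := ⟨k, Finset.mem_range.1 hk, rfl⟩
    rw [hterm, Set.indicator_of_mem hk', Function.comp_apply]
  · intro j hj
    have hj' : j ∉ i '' Set.Iio n := by
      rintro ⟨k, hk, rfl⟩
      exact hj (Finset.mem_image_of_mem i (Finset.mem_range.2 hk))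
    rw [hterm, Set.indicator_of_notMem hj']
    simp

theorem abs_max_min_sub_max_min_le (K a b : ℝ) :
    |max (-K) (min K a) - max (-K) (min K b)| ≤ |a - b| := by
  refine (abs_max_sub_max_le_max _ _ _ _).trans ?_
  rw [sub_self, abs_zero, max_eq_right (abs_nonneg _)]
  refine (abs_min_sub_min_le_max _ _ _ _).trans ?_
  rw [sub_self, abs_zero, max_eq_right (abs_nonneg _)]

theorem AlmostUnifContinuousCoords.of_lipschitz {f F : InfTorus → ℝ} {L : ℝ}
    (hlip : ∀ x y : InfTorus, distP 2 x y ≠ ∞ → |f x - f y| ≤ L * (distP 2 x y).toReal)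
    (hfF : f =ᵐ[torusMeasure] F) : AlmostUnifContinuousCoords F := by
  intro n γ hγ
  set q : InfTorus → ℝ≥0∞ :=
    fun y => (∑ k ∈ Finset.range n, edist (y k) 0 ^ (2 : ℝ)) ^ (1 / 2 : ℝ) with hq
  have hqc : Continuous q := by
    refine ENNReal.continuous_rpow_const.comp (continuous_finsetSum _ fun k _ => ?_)
    exact ENNReal.continuous_rpow_const.comp ((continuous_apply k).edist continuous_const)
  have hq0 : q 0 = 0 := by simp [hq]
  have hpos : 0 < γ / (|L| + 1) := by positivity
  have hev : ∀ᶠ y in 𝓝 (0 : InfTorus), q y < ENNReal.ofReal (γ / (|L| + 1)) :=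
    hqc.continuousAt.eventually_lt continuousAt_const (by rw [hq0]; simpa using hpos)
  filter_upwards [hev] with y hy i hi z hz
  have htr := (measurePreserving_add_right torusMeasure
    ((i '' Set.Iio n).indicator z)).quasiMeasurePreserving.ae hfF
  filter_upwards [hfF, htr] with x hx hx'
  have hd : distP 2 (x + (i '' Set.Iio n).indicator z) x = q y := by
    rw [distP_two_add_indicator_image hi, hz]
  have h := hlip (x + (i '' Set.Iio n).indicator z) x (by rw [hd]; exact hy.ne_top)
  rw [hd, hx, hx'] at h
  have hle : (q y).toReal ≤ γ / (|L| + 1) := ENNReal.toReal_le_of_le_ofReal hpos.le hy.le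
  calc _ ≤ L * (q y).toReal := h
    _ ≤ (|L| + 1) * (q y).toReal := by
      gcongr
      linarith [le_abs_self L]
    _ ≤ (|L| + 1) * (γ / (|L| + 1)) := by gcongr
    _ = γ := by field_simp

theorem exists_nat_measure_abs_gt_lt {g : InfTorus → ℝ} (hg : Measurable g) {δ : ℝ≥0∞}
    (hδ : 0 < δ) : ∃ R : ℕ, torusMeasure {x | (R : ℝ) < |g x|} < δ := by
  have hlim := tendsto_measure_iInter_atTop (μ := torusMeasure)
    (s := fun n : ℕ => {x | (n : ℝ) < |g x|})
    (fun n => (measurableSet_lt measurable_const hg.abs).nullMeasurableSet)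
    (fun m n hmn x hx => (Nat.cast_le (α := ℝ).2 hmn).trans_lt (show (n : ℝ) < |g x| from hx)) ⟨0, measure_ne_top _ _⟩
  have hempty : ⋂ n : ℕ, {x | (n : ℝ) < |g x|} = ∅ := by
    refine Set.eq_empty_of_forall_notMem fun x hx => ?_
    obtain ⟨n, hn⟩ := exists_nat_ge |g x|
    exact absurd (Set.mem_iInter.1 hx n) (not_lt.2 hn)
  rw [hempty, measure_empty] at hlim
  exact (hlim.eventually_lt_const hδ).exists

theorem exists_bound_forall_exists_subtorus {f : InfTorus → ℝ} {L : ℝ}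
    (hmeas : AEMeasurable f torusMeasure)
    (hlip : ∀ x y : InfTorus, distP 2 x y ≠ ∞ → |f x - f y| ≤ L * (distP 2 x y).toReal) :
    ∃ R : ℝ, ∀ ε : ℝ, 0 < ε → ε ≤ 1 → ∃ (A : Set ℕ) (b : InfTorus) (c : ℝ), A.Infinite ∧
      |c| ≤ R ∧ ∀ᵐ y ∂subtorusMeasure A b, |f y - c| ≤ ε := by
  obtain ⟨g, hg, hfg⟩ := hmeas
  obtain ⟨N, hfgN, hN, hN0⟩ := exists_measurable_superset_of_null (ae_iff.1 hfg)
  have hNc : ∀ᵐ x ∂torusMeasure, x ∉ N := measure_eq_zero_iff_ae_notMem.1 hN0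
  have hfgN' : ∀ x ∉ N, f x = g x := fun x hx => by
    by_contra h
    exact hx (hfgN h)
  obtain ⟨R, hR⟩ := exists_nat_measure_abs_gt_lt hg (δ := 1 / 2) (by simp)
  refine ⟨R, fun ε hε hε1 => ?_⟩
  set K : ℝ := R + 2 with hK
  have hR0 : (0 : ℝ) ≤ R := Nat.cast_nonneg R
  set F : InfTorus → ℝ := fun x => max (-K) (min K (g x)) with hF
  have hFm : Measurable F := measurable_const.max (measurable_const.min hg)
  have hFK : ∀ x, |F x| ≤ K := fun x =>
    abs_le.2 ⟨le_max_left _ _, max_le (by linarith) (min_le_left _ _)⟩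
  have hFg : ∀ x, |F x| < K → F x = g x := by
    intro x hx
    have h := abs_lt.1 hx
    simp only [hF] at h ⊢
    rcases le_total K (g x) with h1 | h1
    · rw [min_eq_left h1, max_eq_right (by linarith)] at h
      linarith [h.2]
    · rw [min_eq_right h1] at h ⊢
      rcases le_total (-K) (g x) with h2 | h2
      · exact max_eq_right h2
      · rw [max_eq_left h2] at h
        linarith [h.1]
  have hlipK : ∀ x y : InfTorus, distP 2 x y ≠ ∞ →
      |max (-K) (min K (f x)) - max (-K) (min K (f y))| ≤ L * (distP 2 x y).toReal :=
    fun x y h => (abs_max_min_sub_max_min_le K _ _).trans (hlip x y h)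
  have hFc : AlmostUnifContinuousCoords F := .of_lipschitz hlipK <| by
    filter_upwards [hfg] with x hx
    simp [hF, hx]
  obtain ⟨A, W, hA, hW, hWF⟩ := exists_infinite_ae_abs_sub_le hFm hFK hFc hε
  have hfreq : ∃ᶠ b in ae torusMeasure, b ∈ W ∧ |g b| ≤ R := by
    intro hcon
    have huniv : torusMeasure Set.univ ≤ torusMeasure (Wᶜ ∪ {x | (R : ℝ) < |g x|}) := by
      refine measure_mono_ae ?_
      filter_upwards [hcon] with b hb _
      by_cases hbW : b ∈ W
      · exact Or.inr (not_le.1 fun h => hb ⟨hbW, h⟩)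
      · exact Or.inl hbW
    have hlt : torusMeasure (Wᶜ ∪ {x | (R : ℝ) < |g x|}) < 1 / 2 + 1 / 2 := by
      refine (measure_union_le _ _).trans_lt (ENNReal.add_lt_add_of_le_of_lt ?_ ?_ hR)
      · exact measure_ne_top _ _
      · refine hW.trans (ENNReal.div_le_div_left ?_ _)
        norm_num
    rw [ENNReal.add_halves, ← measure_univ (μ := torusMeasure)] at hlt
    exact absurd huniv (not_le.2 hlt)
  obtain ⟨b, ⟨hbW, hbR⟩, hb, hbN⟩ :=
    (hfreq.and_eventually (hWF.and (ae_ae_add_indicator hNc A))).exists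
  have hFb : F b = g b := by
    have h := abs_le.1 hbR
    simp only [hF]
    rw [min_eq_right (by linarith [h.2]), max_eq_right (by linarith [h.1])]
  refine ⟨A, b, g b, hA, hbR, ?_⟩
  have hkey : ∀ᵐ y ∂subtorusMeasure A b, y ∈ {y | y ∉ N ∧ |g y - g b| ≤ ε} := by
    rw [subtorusMeasure_eq_map_add_indicator]
    refine (mem_ae_map_iff
      (measurable_const.add (measurable_indicator_coords A)).aemeasurable ?_).2 ?_
    · exact hN.compl.inter (measurableSet_le (hg.sub measurable_const).abs measurable_const)
    · filter_upwards [hb hbW, hbN] with z hz hzN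
      refine ⟨hzN, ?_⟩
      rw [hFb] at hz
      have h1 := abs_sub_abs_le_abs_sub (F (b + A.indicator z)) (g b)
      rwa [hFg (b + A.indicator z) (by linarith)] at hz
  filter_upwards [hkey] with y hy
  rw [hfgN' y hy.1]
  exact hy.2

/-- Any measurable, `L`-Lipschitz function w.r.t. the Euclidean metric
`dist₂` on `𝕋^∞` has a spectral value `a`: for every `ε > 0` there is a parallel
infinite-dimensional subtorus (given by an infinite coordinate set `A` and fixed values `b`)
on which `ess sup |f - a| ≤ ε`. -/
theorem lipschitz_spectrum_dist_two (f : InfTorus → ℝ) (L : ℝ)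
    (hmeas : AEMeasurable f torusMeasure)
    (hlip : ∀ x y : InfTorus, distP 2 x y ≠ ∞ → |f x - f y| ≤ L * (distP 2 x y).toReal) :
    ∃ a : ℝ, ∀ ε : ℝ, 0 < ε →
      ∃ (A : Set ℕ) (b : InfTorus), A.Infinite ∧
        essSup (fun x => ENNReal.ofReal |f x - a|) (subtorusMeasure A b) ≤ ENNReal.ofReal ε := by
  obtain ⟨R, hR⟩ := exists_bound_forall_exists_subtorus hmeas hlip
  choose A b c hA hc hf using fun n : ℕ => hR (1 / ((n : ℝ) + 1)) Nat.one_div_pos_of_nat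
    ((div_le_one (by positivity)).2 (by linarith [n.cast_nonneg (α := ℝ)]))
  obtain ⟨a, -, φ, hφ, hlim⟩ := (isCompact_Icc (a := -R) (b := R)).tendsto_subseq
    (x := c) fun n => abs_le.1 (hc n)
  refine ⟨a, fun ε hε => ?_⟩
  have h1 : ∀ᶠ n in atTop, |c (φ n) - a| < ε / 2 :=
    (Metric.tendsto_nhds.1 hlim (ε / 2) (half_pos hε))
  have h2 : ∀ᶠ n in atTop, 1 / ((φ n : ℝ) + 1) < ε / 2 :=
    (tendsto_one_div_add_atTop_nhds_zero_nat.comp hφ.tendsto_atTop).eventually_lt_const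
      (half_pos hε)
  obtain ⟨n, hn1, hn2⟩ := (h1.and h2).exists
  refine ⟨A (φ n), b (φ n), hA (φ n), essSup_le_of_ae_le _ ?_⟩
  filter_upwards [hf (φ n)] with y hy
  refine ENNReal.ofReal_le_ofReal ?_
  have h3 := abs_sub_le (f y) (c (φ n)) a
  linarith
end
end

section
/- Fix p with 1 < p < ∞. For any measurable function f : 𝕋^∞ → ℝ that is L-Lipschitz with respect to the metric dist_p (i.e. |f(x) − f(y)| ≤ L · dist_p(x, y) for all x, y ∈ 𝕋^∞, the condition being vacuous when dist_p(x, y) = +∞), there exists a real number a with the following property: for every ε > 0 there exists a parallel infinite-dimensional subtorus M ⊆ 𝕋^∞ such that the essential supremum of |f − a| over M (with respect to the uniform probability measure on M) is at most ε. -/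
noncomputable section
open MeasureTheory ENNReal Filter
open scoped Classical

instance isAddHaarMeasure_torusMeasure : torusMeasure.IsAddHaarMeasure := by
  unfold torusMeasure; infer_instance

instance regular_torusMeasure : torusMeasure.Regular := by
  unfold torusMeasure; infer_instance

instance isProbabilityMeasure_torusMeasure : IsProbabilityMeasure torusMeasure :=
  ⟨by simpa [torusMeasure] using
    Measure.addHaarMeasure_self (K₀ := (⊤ : TopologicalSpace.PositiveCompacts InfTorus))⟩

theorem AEMeasurable.exists_measure_lt_abs_le {Ω : Type*} [MeasurableSpace Ω] {μ : Measure Ω}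
    [IsFiniteMeasure μ] {f : Ω → ℝ} (hf : AEMeasurable f μ) {η : ℝ≥0∞} (hη : 0 < η) :
    ∃ K : ℝ, 0 ≤ K ∧ μ {x | K < |f x|} ≤ η := by
  have h := tendsto_measure_iInter_atTop (μ := μ) (s := fun n : ℕ => {x | (n : ℝ) < |f x|})
    (fun n => nullMeasurableSet_lt aemeasurable_const hf.abs)
    (fun m n hmn x (hx : (n : ℝ) < |f x|) =>
      show (m : ℝ) < |f x| from (Nat.cast_le.2 hmn).trans_lt hx)
    ⟨0, measure_ne_top _ _⟩
  have h0 : ⋂ n : ℕ, {x | (n : ℝ) < |f x|} = ∅ := by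
    ext x
    obtain ⟨n, hn⟩ := exists_nat_ge |f x|
    simp only [Set.mem_iInter, Set.mem_ofPred_eq, Set.mem_empty_iff_false, iff_false, not_forall,
      not_lt]
    exact ⟨n, hn⟩
  rw [h0, measure_empty] at h
  obtain ⟨n, hn⟩ := (h.eventually (gt_mem_nhds hη)).exists
  exact ⟨n, n.cast_nonneg, hn.le⟩

/-- An almost everywhere measurable function is close in measure to a continuous function. -/
theorem exists_continuous_measure_le {Ω : Type*} [TopologicalSpace Ω] [NormalSpace Ω]
    [MeasurableSpace Ω] [BorelSpace Ω] {μ : Measure Ω} [IsFiniteMeasure μ] [μ.WeaklyRegular]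
    {f : Ω → ℝ} (hf : AEMeasurable f μ) {δ : ℝ} (hδ : 0 < δ) {η : ℝ≥0∞} (hη : 0 < η) :
    ∃ φ : Ω → ℝ, Continuous φ ∧ μ {x | δ ≤ |f x - φ x|} ≤ η := by
  have hη2 : 0 < η / 2 := ENNReal.half_pos hη.ne'
  obtain ⟨K, hK, hKη⟩ := hf.exists_measure_lt_abs_le hη2
  set F : Ω → ℝ := fun x => max (-K) (min K (f x)) with hF
  have hFm : AEMeasurable F μ :=
    (by fun_prop : Measurable fun t : ℝ => max (-K) (min K t)).comp_aemeasurable hf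
  have hFL : MemLp F 1 μ := by
    refine MemLp.of_bound hFm.aestronglyMeasurable K (Eventually.of_forall fun x => ?_)
    rw [Real.norm_eq_abs, abs_le]
    exact ⟨le_max_left _ _, max_le (by linarith) (min_le_left _ _)⟩
  have hδ' : ENNReal.ofReal δ ≠ 0 := by simpa using hδ
  obtain ⟨φ, hφ, hφL⟩ := hFL.exists_boundedContinuous_eLpNorm_sub_le ENNReal.one_ne_top
    (ENNReal.mul_pos hδ' hη2.ne').ne'
  refine ⟨φ, φ.continuous, ?_⟩
  have hM := mul_meas_ge_le_pow_eLpNorm μ one_ne_zero ENNReal.one_ne_top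
    (hFL.sub hφL).aestronglyMeasurable (ENNReal.ofReal δ)
  simp only [ENNReal.toReal_one, ENNReal.rpow_one] at hM
  have hM' := (ENNReal.mul_le_mul_iff_right hδ' ENNReal.ofReal_ne_top).1 (hM.trans hφ)
  calc μ {x | δ ≤ |f x - φ x|}
      ≤ μ ({x | K < |f x|} ∪ {x | ENNReal.ofReal δ ≤ ‖(F - φ) x‖ₑ}) := by
        refine measure_mono fun x hx => ?_
        by_cases h : K < |f x|
        · exact Or.inl h
        · right
          have h' := abs_le.1 (not_lt.1 h)
          have : F x = f x := by simp [hF, h'.1, h'.2]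
          simp only [Set.mem_ofPred_eq, Pi.sub_apply, this, Real.enorm_eq_ofReal_abs]
          exact ENNReal.ofReal_le_ofReal hx
    _ ≤ η / 2 + η / 2 := (measure_union_le _ _).trans (add_le_add hKη hM')
    _ = η := ENNReal.add_halves η

/-- A continuous function on a compact countable product nearly depends on finitely many
coordinates only. -/
theorem Continuous.exists_forall_lt_eq_imp_dist_lt {X Y : Type*} [UniformSpace X] [CompactSpace X]
    [PseudoMetricSpace Y] {φ : (ℕ → X) → Y} (hφ : Continuous φ) {δ : ℝ} (hδ : 0 < δ) :
    ∃ N : ℕ, ∀ x y : ℕ → X, (∀ n < N, x n = y n) → dist (φ x) (φ y) < δ := by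
  have h := CompactSpace.uniformContinuous_of_continuous hφ (Metric.dist_mem_uniformity hδ)
  rw [Filter.mem_map, Pi.uniformity, Filter.mem_iInf] at h
  obtain ⟨I, hI, V, hV, hU⟩ := h
  obtain ⟨N, hN⟩ := hI.bddAbove
  refine ⟨N + 1, fun x y hxy => ?_⟩
  have : (x, y) ∈ ⋂ i, V i := by
    refine Set.mem_iInter.2 fun i => ?_
    obtain ⟨W, hW, hWV⟩ := Filter.mem_comap.1 (hV i)
    apply hWV
    simp only [Set.mem_preimage, hxy i (Nat.lt_succ_of_le (hN i.2))]
    exact refl_mem_uniformity hW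
  rw [← hU] at this
  exact this

/-- Changing coordinates beyond `N`, in a measure-preserving way, hardly affects a measurable
function. -/
theorem AEMeasurable.exists_measure_le_of_forall_lt_eq {f : InfTorus → ℝ}
    (hf : AEMeasurable f torusMeasure) {δ : ℝ} (hδ : 0 < δ) {η : ℝ≥0∞} (hη : 0 < η) :
    ∃ N : ℕ, ∀ {Ω : Type} [MeasurableSpace Ω] {ν : Measure Ω} {w w' : Ω → InfTorus},
      MeasurePreserving w ν torusMeasure → MeasurePreserving w' ν torusMeasure →
      (∀ ω, ∀ n < N, w ω n = w' ω n) → ν {ω | δ ≤ |f (w ω) - f (w' ω)|} ≤ η := by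
  obtain ⟨φ, hφ, hφη⟩ := exists_continuous_measure_le hf (δ := δ / 3) (by positivity)
    (ENNReal.half_pos hη.ne')
  obtain ⟨N, hN⟩ := hφ.exists_forall_lt_eq_imp_dist_lt (δ := δ / 3) (by positivity)
  refine ⟨N, fun {Ω} _ {ν w w'} hw hw' hww' => ?_⟩
  set S := {x | δ / 3 ≤ |f x - φ x|}
  calc ν {ω | δ ≤ |f (w ω) - f (w' ω)|} ≤ ν (w ⁻¹' S ∪ w' ⁻¹' S) := by
        refine measure_mono fun ω hω => ?_
        by_contra h
        simp only [Set.mem_union, Set.mem_preimage, S, Set.mem_ofPred_eq, not_or, not_le,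
          abs_lt] at h
        have h3 := hN _ _ (hww' ω)
        rw [Real.dist_eq, abs_lt] at h3
        have : |f (w ω) - f (w' ω)| < δ := by rw [abs_lt]; constructor <;> linarith
        exact absurd hω (not_le.2 this)
    _ ≤ η / 2 + η / 2 := (measure_union_le _ _).trans <| add_le_add
        ((hw.measure_preimage_le S).trans hφη) ((hw'.measure_preimage_le S).trans hφη)
    _ = η := ENNReal.add_halves η

theorem measurePreserving_subtorusProj (S : Set ℕ) :
    MeasurePreserving (fun z : InfTorus × InfTorus => subtorusProj S z.1 z.2)
      (torusMeasure.prod torusMeasure) torusMeasure := by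
  let F : InfTorus × InfTorus →+ InfTorus :=
    { toFun := fun z => subtorusProj S z.1 z.2
      map_zero' := by ext i; simp [subtorusProj]
      map_add' := fun a b => by
        ext i; by_cases h : i ∈ S <;> simp [subtorusProj, h] }
  have hc : Continuous F := by
    refine continuous_pi fun i => ?_
    by_cases h : i ∈ S
    · simpa [F, subtorusProj, h] using
        (by fun_prop : Continuous fun z : InfTorus × InfTorus => z.2 i)
    · simpa [F, subtorusProj, h] using
        (by fun_prop : Continuous fun z : InfTorus × InfTorus => z.1 i)
  have := Measure.prod.instIsAddHaarMeasure torusMeasure torusMeasure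
  refine F.measurePreserving hc (fun x => ⟨(x, x), ?_⟩) (by simp)
  ext i
  simp [F, subtorusProj]

theorem abs_sub_le_of_eq_off_singleton {p : ℝ} (hp : 1 < p) {f : InfTorus → ℝ} {L : ℝ}
    (hlip : ∀ x y : InfTorus, distP p x y ≠ ∞ → |f x - f y| ≤ L * (distP p x y).toReal)
    {x y : InfTorus} {i : ℕ} (h : ∀ j ≠ i, x j = y j) :
    |f x - f y| ≤ |L| * dist (x i) (y i) := by
  have hp0 : 0 < p := by linarith
  have hd : distP p x y = edist (x i) (y i) := by
    unfold distP
    rw [tsum_eq_single i fun j hj => by simp [h j hj, hp0], ← ENNReal.rpow_mul,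
      mul_one_div_cancel hp0.ne', ENNReal.rpow_one]
  have := hlip x y (by rw [hd]; exact edist_ne_top _ _)
  rw [hd, ← dist_edist] at this
  exact this.trans (mul_le_mul_of_nonneg_right (le_abs_self L) dist_nonneg)

theorem abs_sub_le_card_mul {f : InfTorus → ℝ} {L : ℝ}
    (hf : ∀ (x y : InfTorus) (i : ℕ), (∀ j ≠ i, x j = y j) → |f x - f y| ≤ L * dist (x i) (y i))
    (hL : 0 ≤ L) {r : ℝ} (s : Finset ℕ) :
    ∀ x y : InfTorus, (∀ i ∉ s, x i = y i) → (∀ i ∈ s, dist (x i) (y i) ≤ r) →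
      |f x - f y| ≤ s.card * (L * r) := by
  induction s using Finset.induction_on with
  | empty =>
    intro x y h _
    obtain rfl : x = y := funext fun i => h i (by simp)
    simp
  | insert a s ha ih =>
    intro x y h hr
    have h1 := hf x (Function.update x a (y a)) a fun j hj => by simp [hj]
    have h2 := ih (Function.update x a (y a)) y
      (fun i hi => by
        by_cases hia : i = a
        · subst hia; simp
        · simpa [hia] using h i (by simp [hia, hi]))
      (fun i hi => by
        have hia : i ≠ a := fun e => ha (e ▸ hi)
        simpa [hia] using hr i (by simp [hi]))
    have h3 : L * dist (x a) (y a) ≤ L * r :=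
      mul_le_mul_of_nonneg_left (hr a (by simp)) hL
    rw [Function.update_self] at h1
    rw [Finset.card_insert_of_notMem ha]
    push_cast
    linarith [abs_sub_le (f x) (f (Function.update x a (y a))) (f y)]

theorem measurable_subtorusProj (A : Set ℕ) (b : InfTorus) : Measurable (subtorusProj A b) := by
  refine measurable_pi_lambda _ fun i => ?_
  by_cases h : i ∈ A
  · simpa [subtorusProj, h] using measurable_pi_apply i
  · simp [subtorusProj, h]

/-- The point of `𝕋^∞` with coordinates `u j` at `i j` for `j < k`, and `0` elsewhere. -/
def finiteShift (i : ℕ → ℕ) (k : ℕ) (u : ℕ → AddCircle (1 : ℝ)) : InfTorus :=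
  Function.extend i (fun j => if j < k then u j else 0) 0

theorem finiteShift_apply {i : ℕ → ℕ} (hi : Function.Injective i) (k : ℕ)
    (u : ℕ → AddCircle (1 : ℝ)) (j : ℕ) :
    finiteShift i k u (i j) = if j < k then u j else 0 :=
  hi.extend_apply _ _ _

theorem finiteShift_apply_of_notMem {i : ℕ → ℕ} {k n : ℕ} (u : ℕ → AddCircle (1 : ℝ))
    (hn : n ∉ Set.range i) : finiteShift i k u n = 0 :=
  Function.extend_apply' _ _ _ hn

theorem finiteShift_zero (i : ℕ → ℕ) (u : ℕ → AddCircle (1 : ℝ)) : finiteShift i 0 u = 0 := by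
  unfold finiteShift
  funext n
  by_cases h : ∃ j, i j = n <;> simp [Function.extend, h]

theorem finiteShift_succ_apply_of_lt {i : ℕ → ℕ} (hi : Function.Injective i) {k n : ℕ}
    (u : ℕ → AddCircle (1 : ℝ)) (hn : n < i k) :
    finiteShift i (k + 1) u n = finiteShift i k u n := by
  by_cases h : n ∈ Set.range i
  · obtain ⟨j, rfl⟩ := h
    have : j ≠ k := by rintro rfl; exact lt_irrefl _ hn
    rw [finiteShift_apply hi, finiteShift_apply hi]
    congr 1
    simp only [eq_iff_iff]
    omega
  · rw [finiteShift_apply_of_notMem u h, finiteShift_apply_of_notMem u h]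

theorem add_finiteShift_eq_subtorusProj {i : ℕ → ℕ} (hi : Function.Injective i) (k : ℕ)
    (x y : InfTorus) :
    y + finiteShift i k (fun j => x (i j) - y (i j)) = subtorusProj (i '' Set.Iio k) y x := by
  ext n
  by_cases h : n ∈ Set.range i
  · obtain ⟨j, rfl⟩ := h
    by_cases hj : j < k <;> simp [finiteShift_apply hi, subtorusProj, hi.eq_iff, hj]
  · have : n ∉ i '' Set.Iio k := fun h' => h (Set.image_subset_range _ _ h')
    simp [finiteShift_apply_of_notMem _ h, subtorusProj, this]

theorem abs_sub_add_finiteShift_le {f : InfTorus → ℝ} {L : ℝ}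
    (hf : ∀ (x y : InfTorus) (i : ℕ), (∀ j ≠ i, x j = y j) → |f x - f y| ≤ L * dist (x i) (y i))
    (hL : 0 ≤ L) {i : ℕ → ℕ} (hi : Function.Injective i) {m k : ℕ} (hmk : m ≤ k) {r : ℝ}
    {u v : ℕ → AddCircle (1 : ℝ)} (huv : ∀ j < k, dist (u j) (v j) ≤ r) (hr : 0 ≤ r)
    (y : InfTorus) :
    |f (y + finiteShift i m u) - f (y + finiteShift i m v)| ≤ k * (L * r) := by
  have h := abs_sub_le_card_mul hf hL (r := r) ((Finset.range m).image i)
    (y + finiteShift i m u) (y + finiteShift i m v)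
    (fun n hn => by
      by_cases h : n ∈ Set.range i
      · obtain ⟨j, rfl⟩ := h
        have : ¬ j < m := fun hj => hn (Finset.mem_image_of_mem _ (Finset.mem_range.2 hj))
        simp [finiteShift_apply hi, this]
      · simp [finiteShift_apply_of_notMem _ h])
    (fun n hn => by
      obtain ⟨j, hj, rfl⟩ := Finset.mem_image.1 hn
      have hj := Finset.mem_range.1 hj
      simpa [finiteShift_apply hi, hj] using huv j (by omega))
  rw [Finset.card_image_of_injective _ hi, Finset.card_range] at h
  exact h.trans (mul_le_mul_of_nonneg_right (by exact_mod_cast hmk) (by positivity))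

theorem exists_finset_forall_exists_dist_lt {X : Type*} [PseudoMetricSpace X] [CompactSpace X]
    {r : ℝ} (hr : 0 < r) : ∃ G : Finset X, ∀ t : X, ∃ g ∈ G, dist t g < r := by
  obtain ⟨s, -, hs, hcov⟩ := finite_cover_balls_of_compact (isCompact_univ (X := X)) hr
  refine ⟨hs.toFinset, fun t => ?_⟩
  simpa using hcov (Set.mem_univ t)

/-- Along sufficiently sparse coordinates `i`, for most base points `y`, successively modifying
the coordinates `i 0, i 1, …` of `y` changes `f` by a summable sequence of amounts. -/
theorem exists_sparse_coordinates {f : InfTorus → ℝ} (hmeas : AEMeasurable f torusMeasure) {L : ℝ}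
    (hf : ∀ (x y : InfTorus) (i : ℕ), (∀ j ≠ i, x j = y j) → |f x - f y| ≤ L * dist (x i) (y i))
    (hL : 0 ≤ L) {e : ℕ → ℝ} (he : ∀ k, 0 < e k) {d : ℕ → ℝ≥0∞} (hd : ∀ k, 0 < d k)
    (hdsum : ∑' k, d k ≠ ∞) :
    ∃ i : ℕ → ℕ, StrictMono i ∧
      torusMeasure {y | ∃ k u, 3 * e k <
        |f (y + finiteShift i (k + 1) u) - f (y + finiteShift i k u)|} ≤ ∑' k, d k ∧
      ∀ᵐ y ∂torusMeasure, ∀ᵐ x ∂torusMeasure, ∀ᶠ k in atTop,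
        |f (subtorusProj (Set.range i) y x) - f (subtorusProj (i '' Set.Iio k) y x)| < e k := by
  have hr : ∀ k : ℕ, 0 < e k / ((k + 1) * (L + 1)) := fun k => by have := he k; positivity
  choose G hG using fun k => exists_finset_forall_exists_dist_lt (X := AddCircle (1 : ℝ)) (hr k)
  choose ρ hρG hρ using hG
  let C : ℕ → ℕ := fun k => Fintype.card (Fin (k + 1) → G k)
  have hη : ∀ k, 0 < d k / (C k + 1) := fun k =>
    ENNReal.div_pos (hd k).ne' (by finiteness)
  choose N hN using fun k => hmeas.exists_measure_le_of_forall_lt_eq (he k) (hη k)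
  have hηd : ∀ k, C k * (d k / (C k + 1)) ≤ d k := fun k => by
    rw [← mul_div_assoc]
    refine ENNReal.div_le_of_le_mul ?_
    rw [mul_comm]
    gcongr
    exact le_self_add
  have hηd' : ∀ k, d k / (C k + 1) ≤ d k := fun k =>
    ENNReal.div_le_of_le_mul (by
      nth_rewrite 1 [← mul_one (d k)]
      gcongr
      exact le_add_self)
  obtain ⟨i, hi, hiN⟩ := extraction_forall_of_eventually
    (P := fun n k => N n ≤ k) fun n => eventually_ge_atTop (N n)
  refine ⟨i, hi, ?_, ?_⟩
  · let v : ∀ k, (Fin (k + 1) → G k) → ℕ → AddCircle (1 : ℝ) := fun k w j =>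
      if h : j < k + 1 then w ⟨j, h⟩ else 0
    let B : ∀ k, (Fin (k + 1) → G k) → Set InfTorus := fun k w =>
      {y | e k ≤ |f (y + finiteShift i (k + 1) (v k w)) - f (y + finiteShift i k (v k w))|}
    have hB : ∀ k w, torusMeasure (B k w) ≤ d k / (C k + 1) := fun k w =>
      hN k (measurePreserving_add_right torusMeasure _) (measurePreserving_add_right torusMeasure _)
        fun y n hn => by
          simp only [Pi.add_apply,
            finiteShift_succ_apply_of_lt hi.injective _ (hn.trans_le (hiN k))]
    calc _ ≤ torusMeasure (⋃ k, ⋃ w, B k w) := by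
          refine measure_mono ?_
          rintro y ⟨k, u, hy⟩
          simp only [Set.mem_iUnion]
          refine ⟨k, fun j => ⟨ρ k (u j), hρG k (u j)⟩, ?_⟩
          set w : Fin (k + 1) → G k := fun j => ⟨ρ k (u j), hρG k (u j)⟩ with hw
          have huv : ∀ j < k + 1, dist (u j) (v k w j) ≤ e k / ((k + 1) * (L + 1)) :=
            fun j hj => by simpa [v, Nat.lt_succ_iff.1 hj, hw] using (hρ k (u j)).le
          have h1 := abs_le.1 <|
            abs_sub_add_finiteShift_le hf hL hi.injective le_rfl huv (hr k).le y
          have h2 := abs_le.1 <|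
            abs_sub_add_finiteShift_le hf hL hi.injective k.le_succ huv (hr k).le y
          have h3 : ((k + 1 : ℕ) : ℝ) * (L * (e k / ((k + 1) * (L + 1)))) ≤ e k := by
            have : ((k + 1 : ℕ) : ℝ) * (L * (e k / ((k + 1) * (L + 1)))) = e k * (L / (L + 1)) := by
              push_cast
              field_simp
            rw [this]
            exact mul_le_of_le_one_right (he k).le (div_le_one_of_le₀ (by linarith) (by linarith))
          rw [lt_abs] at hy
          simp only [B, Set.mem_ofPred_eq, le_abs]
          rcases hy with hy | hy
          · left; linarith
          · right; linarith
      _ ≤ ∑' k, torusMeasure (⋃ w, B k w) := measure_iUnion_le _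
      _ ≤ ∑' k, d k := by
          refine ENNReal.tsum_le_tsum fun k => ?_
          refine (measure_iUnion_fintype_le _ _).trans ?_
          refine (Finset.sum_le_sum fun w _ => hB k w).trans ?_
          rw [Finset.sum_const, nsmul_eq_mul]
          exact hηd k
  · refine Measure.ae_ae_of_ae_prod (p := fun z => ∀ᶠ k in atTop,
      |f (subtorusProj (Set.range i) z.1 z.2) - f (subtorusProj (i '' Set.Iio k) z.1 z.2)| < e k) ?_
    have h := ae_eventually_notMem (μ := torusMeasure.prod torusMeasure)
      (s := fun k => {z | e k ≤ |f (subtorusProj (Set.range i) z.1 z.2) -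
        f (subtorusProj (i '' Set.Iio k) z.1 z.2)|})
      (ne_top_of_le_ne_top hdsum <| ENNReal.tsum_le_tsum fun k => (hN k
        (measurePreserving_subtorusProj _) (measurePreserving_subtorusProj _)
        fun z n hn => ?_).trans (hηd' k))
    · simpa only [Set.mem_ofPred_eq, not_le] using h
    · have : n ∈ Set.range i ↔ n ∈ i '' Set.Iio k := by
        refine ⟨?_, fun h => Set.image_subset_range _ _ h⟩
        rintro ⟨j, rfl⟩
        exact Set.mem_image_of_mem _ (hi.lt_iff_lt.1 (hn.trans_le (hiN k)))
      simp only [subtorusProj, this]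

theorem exists_subtorus_ae_abs_sub_le {f : InfTorus → ℝ} (hmeas : AEMeasurable f torusMeasure)
    {L : ℝ}
    (hf : ∀ (x y : InfTorus) (i : ℕ), (∀ j ≠ i, x j = y j) → |f x - f y| ≤ L * dist (x i) (y i))
    (hL : 0 ≤ L) {K : ℝ} (hK : torusMeasure {x | K < |f x|} ≤ 1 / 2) {ε : ℝ} (hε : 0 < ε) :
    ∃ a : ℝ, |a| ≤ K ∧ ∃ (A : Set ℕ) (b : InfTorus), A.Infinite ∧
      ∀ᵐ w ∂subtorusMeasure A b, |f w - a| ≤ ε := by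
  obtain ⟨e, he, c, hc, hcε⟩ := NNReal.exists_pos_sum_of_countable
    (ε := (ε / 4).toNNReal) (by simpa using hε) ℕ
  obtain ⟨d, hd, hdsum⟩ := ENNReal.exists_pos_sum_of_countable (ε := 1 / 2) (by simp) ℕ
  obtain ⟨i, hi, hbad, hlim⟩ := exists_sparse_coordinates hmeas hf hL (e := fun k => (e k : ℝ))
    (fun k => he k) (d := fun k => d k) (fun k => by exact_mod_cast hd k) hdsum.ne_top
  have hsum : ∀ s : Finset ℕ, ∑ j ∈ s, (e j : ℝ) ≤ ε / 4 := fun s => by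
    have h1 : ∑ j ∈ s, e j ≤ (ε / 4).toNNReal :=
      (hc.tsum_eq ▸ hc.summable.sum_le_tsum s fun _ _ => zero_le).trans hcε.le
    have h2 : ((∑ j ∈ s, e j : NNReal) : ℝ) ≤ ((ε / 4).toNNReal : ℝ) := by exact_mod_cast h1
    rwa [Real.coe_toNNReal _ (by positivity), NNReal.coe_sum] at h2
  let Z := toMeasurable torusMeasure {x | f x ≠ hmeas.mk f x}
  have hZ : torusMeasure Z = 0 := by
    rw [measure_toMeasurable]; exact ae_iff.1 hmeas.ae_eq_mk
  have hZ' : ∀ᵐ y ∂torusMeasure, ∀ᵐ x ∂torusMeasure, subtorusProj (Set.range i) y x ∉ Z :=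
    Measure.ae_ae_of_ae_prod <|
      (measurePreserving_subtorusProj (Set.range i)).quasiMeasurePreserving.ae
        (measure_eq_zero_iff_ae_notMem.1 hZ)
  set S := {y | ∃ k u, 3 * (e k : ℝ) <
    |f (y + finiteShift i (k + 1) u) - f (y + finiteShift i k u)|} with hS
  have hgood : ∃ᵐ y ∂torusMeasure, y ∉ {x | K < |f x|} ∪ S := by
    intro h
    have h0 : torusMeasure ({x | K < |f x|} ∪ S)ᶜ = 0 := measure_eq_zero_iff_ae_notMem.2 h
    have h1 : (1 : ℝ≥0∞) < 1 := calc
      1 = torusMeasure Set.univ := measure_univ.symm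
      _ = torusMeasure (({x | K < |f x|} ∪ S) ∪ ({x | K < |f x|} ∪ S)ᶜ) := by
        rw [Set.union_compl_self]
      _ ≤ torusMeasure {x | K < |f x|} + torusMeasure S + 0 :=
        (measure_union_le _ _).trans (add_le_add (measure_union_le _ _) h0.le)
      _ < 1 / 2 + 1 / 2 := by
        rw [add_zero]
        exact ENNReal.add_lt_add_of_le_of_lt (by finiteness) hK (hbad.trans_lt hdsum)
      _ = 1 := ENNReal.add_halves 1
    exact lt_irrefl _ h1
  obtain ⟨y, hy, hylim, hyZ⟩ := (hgood.and_eventually (hlim.and hZ')).exists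
  simp only [Set.mem_union, not_or, hS, Set.mem_ofPred_eq, not_lt, not_exists] at hy
  obtain ⟨hyK, hyS⟩ := hy
  have htel : ∀ k u, |f (y + finiteShift i k u) - f y| ≤ 3 * ∑ j ∈ Finset.range k, (e j : ℝ) := by
    intro k u
    induction k with
    | zero => simp [finiteShift_zero]
    | succ k ih =>
      rw [Finset.sum_range_succ]
      linarith [hyS k u, abs_sub_le (f (y + finiteShift i (k + 1) u))
        (f (y + finiteShift i k u)) (f y)]
  refine ⟨f y, hyK, Set.range i, y, Set.infinite_range_of_injective hi.injective, ?_⟩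
  have hmk : ∀ᵐ w ∂subtorusMeasure (Set.range i) y, w ∉ Z ∧ |hmeas.mk f w - f y| ≤ ε := by
    have hms : MeasurableSet {w | w ∉ Z ∧ |hmeas.mk f w - f y| ≤ ε} :=
      (measurableSet_toMeasurable _ _).compl.inter
        (measurableSet_le (hmeas.measurable_mk.sub_const _).abs measurable_const)
    rw [subtorusMeasure, ae_map_iff (measurable_subtorusProj _ _).aemeasurable hms]
    filter_upwards [hylim, hyZ] with x hx hxZ
    refine ⟨hxZ, ?_⟩
    have hfx : f (subtorusProj (Set.range i) y x) = hmeas.mk f (subtorusProj (Set.range i) y x) :=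
      not_not.1 fun h => hxZ (subset_toMeasurable _ _ h)
    obtain ⟨k, hk⟩ := hx.exists
    have h1 := htel k fun j => x (i j) - y (i j)
    rw [add_finiteShift_eq_subtorusProj hi.injective] at h1
    rw [← hfx]
    have h2 := hsum {k}
    rw [Finset.sum_singleton] at h2
    linarith [hsum (Finset.range k), abs_sub_le (f (subtorusProj (Set.range i) y x))
      (f (subtorusProj (i '' Set.Iio k) y x)) (f y)]
  filter_upwards [hmk] with w hw
  have hfw : f w = hmeas.mk f w := not_not.1 fun h => hw.1 (subset_toMeasurable _ _ h)
  rw [hfw]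
  exact hw.2

/-- For `1 < p < ∞`, any measurable, `L`-Lipschitz function w.r.t. `dist_p`
on `𝕋^∞` has a spectral value `a`: for every `ε > 0` there is a parallel
infinite-dimensional subtorus (given by an infinite coordinate set `A` and fixed values `b`)
on which `ess sup |f - a| ≤ ε`. -/
theorem lipschitz_spectrum_dist_p (p : ℝ) (hp : 1 < p) (f : InfTorus → ℝ) (L : ℝ)
    (hmeas : AEMeasurable f torusMeasure)
    (hlip : ∀ x y : InfTorus, distP p x y ≠ ∞ → |f x - f y| ≤ L * (distP p x y).toReal) :
    ∃ a : ℝ, ∀ ε : ℝ, 0 < ε →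
      ∃ (A : Set ℕ) (b : InfTorus), A.Infinite ∧
        essSup (fun x => ENNReal.ofReal |f x - a|) (subtorusMeasure A b) ≤ ENNReal.ofReal ε := by
  obtain ⟨K, -, hK⟩ := hmeas.exists_measure_lt_abs_le (η := 1 / 2) (by simp)
  have hf := fun x y i => abs_sub_le_of_eq_off_singleton hp hlip (x := x) (y := y) (i := i)
  choose a haK A b hA hae using fun n : ℕ => exists_subtorus_ae_abs_sub_le hmeas hf (abs_nonneg L)
    hK (Nat.one_div_pos_of_nat (α := ℝ) (n := n))
  obtain ⟨a₀, -, φ, hφ, hlim⟩ := (isCompact_Icc (a := -K) (b := K)).tendsto_subseq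
    fun n => abs_le.1 (haK n)
  refine ⟨a₀, fun ε hε => ?_⟩
  have h1 := hlim.eventually (Metric.ball_mem_nhds a₀ (half_pos hε))
  have h2 := (tendsto_one_div_add_atTop_nhds_zero_nat (𝕜 := ℝ)).comp hφ.tendsto_atTop
    |>.eventually (gt_mem_nhds (half_pos hε))
  obtain ⟨n, hn1, hn2⟩ := (h1.and h2).exists
  refine ⟨A (φ n), b (φ n), hA _, essSup_le_of_ae_le _ ?_⟩
  filter_upwards [hae (φ n)] with w hw
  refine ENNReal.ofReal_le_ofReal ?_
  simp only [Function.comp_apply, Real.dist_eq] at hn1 hn2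
  linarith [abs_sub_le (f w) (a (φ n)) a₀]
end
end

section
/- For any measurable function f : 𝕋^∞ → ℝ that is L-Lipschitz with respect to the supremum metric dist_∞ (i.e. |f(x) − f(y)| ≤ L · dist_∞(x, y) for all x, y ∈ 𝕋^∞), there exists a real number a with the following property: for every ε > 0 there exists a parallel infinite-dimensional subtorus M ⊆ 𝕋^∞ such that the essential supremum of |f − a| over M (with respect to the uniform probability measure on M) is at most ε. -/
noncomputable section
open MeasureTheory ENNReal Filter
open scoped Classical

/-- The supremum metric `dist_∞(x,y) = supᵢ dist(xᵢ,yᵢ)` on the infinite torus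
(always finite, since `dist ≤ 1/2` on `ℝ/ℤ`). -/
def distInfty (x y : InfTorus) : ℝ := ⨆ i, dist (x i) (y i)

instance : Measure.IsAddHaarMeasure torusMeasure :=
  inferInstanceAs (Measure.IsAddHaarMeasure (Measure.addHaarMeasure ⊤))

/-- A nonzero measure charges every neighbourhood of the fibre over some value of a real
almost everywhere measurable function. -/
lemma exists_forall_measure_preimage_ball_pos {X : Type*} [MeasurableSpace X] {μ : Measure X}
    {f : X → ℝ} (hf : AEMeasurable f μ) (hμ : μ ≠ 0) :
    ∃ a : ℝ, ∀ ε : ℝ, 0 < ε → 0 < μ (f ⁻¹' Metric.ball a ε) := by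
  have hmap : μ.map f ≠ 0 := (Measure.map_ne_zero_iff hf).2 hμ
  obtain ⟨a, ha⟩ := Measure.nonempty_support hmap
  refine ⟨a, fun ε hε => ?_⟩
  rw [← Measure.map_apply_of_aemeasurable hf Metric.isOpen_ball.measurableSet]
  exact (Measure.mem_support_iff_forall a).1 ha _ (Metric.ball_mem_nhds a hε)

/-- Almost every point for the measure of a subtorus lies in that subtorus. -/
lemma ae_subtorusMeasure (A : Set ℕ) (b : InfTorus) :
    ∀ᵐ x ∂subtorusMeasure A b, ∀ i ∉ A, x i = b i := by
  have hproj : Measurable (subtorusProj A b) := by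
    refine measurable_pi_lambda _ fun i => ?_
    by_cases hi : i ∈ A <;> simp only [subtorusProj, hi, if_true, if_false]
    · exact measurable_pi_apply i
    · exact measurable_const
  refine ae_all_iff.2 fun i => ?_
  by_cases hi : i ∈ A
  · simp [hi]
  · have hset : MeasurableSet {x : InfTorus | i ∉ A → x i = b i} := by
      simp only [hi, not_false_eq_true, forall_const]
      exact (isClosed_singleton.preimage (continuous_apply i)).measurableSet
    refine (ae_map_iff hproj.aemeasurable hset).2 (Eventually.of_forall fun x _ => ?_)
    simp [subtorusProj, hi]

/-- Elements supported on a single coordinate tend to zero as the coordinate goes to infinity. -/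
lemma tendsto_single_atTop (h : AddCircle (1 : ℝ)) :
    Tendsto (fun i : ℕ => (Pi.single i h : InfTorus)) atTop (nhds 0) := by
  refine tendsto_pi_nhds.2 fun j => tendsto_const_nhds.congr' ?_
  filter_upwards [eventually_gt_atTop j] with i hi
  simp [hi.ne]

open scoped Pointwise in
/-- A compact set of positive measure contains a compact set of positive measure all of whose
translates by given finitely many elements along a sufficiently late coordinate stay in the
original set. -/
lemma exists_isCompact_forall_add_single_mem (F : Finset (AddCircle (1 : ℝ))) {K : Set InfTorus}
    (hK : IsCompact K) (hpos : 0 < torusMeasure K) (n : ℕ) :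
    ∃ i ≥ n, ∃ K' ⊆ K, IsCompact K' ∧ 0 < torusMeasure K' ∧
      ∀ h ∈ F, ∀ x ∈ K', x + Pi.single i h ∈ K := by
  have hsum : Tendsto (fun i : ℕ => ∑ h ∈ F,
      torusMeasure ((-(Pi.single i h : InfTorus) +ᵥ K) \ K)) atTop (nhds 0) := by
    rw [← Finset.sum_const_zero (s := F) (ι := AddCircle (1 : ℝ))]
    refine tendsto_finsetSum F fun h _ => ?_
    refine (tendsto_measure_vadd_sdiff_isCompact_isClosed hK hK.isClosed).comp ?_
    simpa using (tendsto_single_atTop h).neg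
  have hdiff (g : InfTorus) : torusMeasure (K \ (-g +ᵥ K)) = torusMeasure ((-g +ᵥ K) \ K) := by
    have hm : MeasurableSet (-g +ᵥ K) := (hK.vadd (-g)).measurableSet
    refine measure_sdiff_symm hK.measurableSet.nullMeasurableSet hm.nullMeasurableSet ?_
      (measure_ne_top _ _)
    rw [measure_vadd]
  obtain ⟨i, hi, hin⟩ :=
    ((hsum.eventually (gt_mem_nhds hpos)).and (eventually_ge_atTop n)).exists
  refine ⟨i, hin, K ∩ ⋂ h ∈ F, (-(Pi.single i h : InfTorus) +ᵥ K), Set.inter_subset_left,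
    hK.inter_right (isClosed_biInter fun h _ => (hK.vadd _).isClosed), ?_, ?_⟩
  · rw [pos_iff_ne_zero]
    intro h0
    refine hi.not_ge ?_
    calc torusMeasure K
        ≤ torusMeasure (⋃ h ∈ F, K \ (-(Pi.single i h : InfTorus) +ᵥ K)) := by
          rw [← measure_sdiff_null (s := K) h0]
          refine measure_mono fun x hx => ?_
          simp only [Set.mem_sdiff, Set.mem_inter_iff, Set.mem_iInter, not_and, not_forall] at hx
          obtain ⟨h, hF, hn⟩ := hx.2 hx.1
          exact Set.mem_biUnion hF ⟨hx.1, hn⟩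
      _ ≤ ∑ h ∈ F, torusMeasure (K \ (-(Pi.single i h : InfTorus) +ᵥ K)) :=
          measure_biUnion_finset_le _ _
      _ = _ := Finset.sum_congr rfl fun h _ => hdiff _
  · intro h hF x hx
    have := Set.mem_iInter₂.1 hx.2 h hF
    rw [Set.mem_vadd_set_iff_neg_vadd_mem, neg_neg, vadd_eq_add, add_comm] at this
    exact this

/-- For a finite set `F`, a compact set of positive measure contains a translate of the set of
all `F`-valued sequences supported on some infinite set of coordinates. -/
lemma exists_infinite_forall_mem (F : Finset (AddCircle (1 : ℝ))) {K : Set InfTorus}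
    (hK : IsCompact K) (hpos : 0 < torusMeasure K) :
    ∃ (A : Set ℕ) (p : InfTorus), A.Infinite ∧
      ∀ y : InfTorus, (∀ i ∈ A, y i - p i ∈ F) → (∀ i ∉ A, y i = p i) → y ∈ K := by
  choose idx hidx next hsub hcomp hnpos hmem using
    fun (S : {S : Set InfTorus // IsCompact S ∧ 0 < torusMeasure S}) (n : ℕ) =>
      exists_isCompact_forall_add_single_mem F S.2.1 S.2.2 n
  let s : ℕ → {S : Set InfTorus // IsCompact S ∧ 0 < torusMeasure S} × ℕ := fun k =>
    Nat.rec (⟨K, hK, hpos⟩, 0)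
      (fun _ t => (⟨next t.1 t.2, hcomp t.1 t.2, hnpos t.1 t.2⟩, idx t.1 t.2 + 1)) k
  let a : ℕ → ℕ := fun k => idx (s k).1 (s k).2
  have ha : StrictMono a := strictMono_nat_of_lt_succ fun k => hidx (s (k + 1)).1 (s (k + 1)).2
  have hfin (k : ℕ) : ∀ x ∈ ((s k).1 : Set InfTorus), ∀ y : InfTorus,
      (∀ j < k, y (a j) - x (a j) ∈ F) → (∀ i, (∀ j < k, i ≠ a j) → y i = x i) → y ∈ K := by
    induction k with
    | zero =>
      intro x hx y _ hy
      rwa [funext fun i => hy i (by simp)]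
    | succ k ih =>
      intro x hx y hyF hy
      have hx' := hmem (s k).1 (s k).2 _ (hyF k k.lt_succ_self) x hx
      refine ih _ hx' y (fun j hj => ?_) fun i hi => ?_
      · have hne : a j ≠ a k := (ha hj).ne
        simpa [a, Pi.single_apply, hne] using hyF j (hj.trans k.lt_succ_self)
      · by_cases hik : i = a k
        · subst hik; simp [a]
        · have : y i = x i := hy i fun j hj => by
            rcases Nat.lt_succ_iff_lt_or_eq.1 hj with h | rfl
            · exact hi j h
            · exact hik
          have hik' : i ≠ idx (s k).1 (s k).2 := hik
          simp [this, hik']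
  obtain ⟨p, hp⟩ : (⋂ k, ((s k).1 : Set InfTorus)).Nonempty :=
    IsCompact.nonempty_iInter_of_sequence_nonempty_isCompact_isClosed _
      (fun k => hsub (s k).1 (s k).2)
      (fun k => nonempty_of_measure_ne_zero (s k).1.2.2.ne') (s 0).1.2.1
      fun k => (s k).1.2.1.isClosed
  refine ⟨Set.range a, p, Set.infinite_range_of_injective ha.injective, fun y hyF hy => ?_⟩
  have hlim : Tendsto (fun k : ℕ => (fun i => if ∃ j < k, i = a j then y i else p i : InfTorus))
      atTop (nhds y) := by
    refine tendsto_pi_nhds.2 fun i => tendsto_const_nhds.congr' ?_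
    by_cases hi : i ∈ Set.range a
    · obtain ⟨j, rfl⟩ := hi
      filter_upwards [eventually_gt_atTop j] with k hk
      rw [if_pos ⟨j, hk, rfl⟩]
    · exact Eventually.of_forall fun k => by simp [hy i hi]
  refine hK.isClosed.mem_of_tendsto hlim (Eventually.of_forall fun k => ?_)
  refine hfin k p (Set.mem_iInter.1 hp k) _ (fun j hj => ?_) fun i hi => ?_
  · rw [if_pos ⟨j, hj, rfl⟩]
    exact hyF _ ⟨j, rfl⟩
  · exact if_neg fun ⟨j, hj, h⟩ => hi j hj h

/-- Every neighbourhood, in the supremum metric, of a compact set of positive measure contains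
an infinite-dimensional parallel subtorus. -/
lemma exists_subtorus_distInfty_le {K : Set InfTorus} (hK : IsCompact K)
    (hpos : 0 < torusMeasure K) {δ : ℝ} (hδ : 0 < δ) :
    ∃ (A : Set ℕ) (b : InfTorus), A.Infinite ∧
      ∀ x : InfTorus, (∀ i ∉ A, x i = b i) → ∃ y ∈ K, distInfty x y ≤ δ := by
  obtain ⟨t, -, htfin, ht⟩ :=
    finite_cover_balls_of_compact (isCompact_univ (X := AddCircle (1 : ℝ))) hδ
  obtain ⟨A, p, hA, hp⟩ := exists_infinite_forall_mem htfin.toFinset hK hpos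
  refine ⟨A, p, hA, fun x hx => ?_⟩
  have hnear (u : AddCircle (1 : ℝ)) : ∃ h ∈ t, dist u h < δ := by
    simpa using ht (Set.mem_univ u)
  choose g hgt hg using hnear
  refine ⟨fun i => if i ∈ A then p i + g (x i - p i) else p i,
    hp _ (fun i hi => by simp [hi, hgt]) fun i hi => by simp [hi], ciSup_le fun i => ?_⟩
  by_cases hi : i ∈ A
  · have := (hg (x i - p i)).le
    simp only [hi, if_true]
    rwa [← dist_add_left (p i), add_sub_cancel] at this
  · simp [hi, hx i hi, hδ.le]

/-- Any measurable, `L`-Lipschitz function w.r.t. the supremum metric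
`dist_∞` on `𝕋^∞` has a spectral value `a`: for every `ε > 0` there is a parallel
infinite-dimensional subtorus (given by an infinite coordinate set `A` and fixed values `b`)
on which `ess sup |f - a| ≤ ε`. -/
theorem lipschitz_spectrum_dist_infty (f : InfTorus → ℝ) (L : ℝ)
    (hmeas : AEMeasurable f torusMeasure)
    (hlip : ∀ x y : InfTorus, |f x - f y| ≤ L * distInfty x y) :
    ∃ a : ℝ, ∀ ε : ℝ, 0 < ε →
      ∃ (A : Set ℕ) (b : InfTorus), A.Infinite ∧
        essSup (fun x => ENNReal.ofReal |f x - a|) (subtorusMeasure A b) ≤ ENNReal.ofReal ε := by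
  have hne : torusMeasure ≠ 0 := NeZero.ne _
  obtain ⟨a, ha⟩ := exists_forall_measure_preimage_ball_pos hmeas hne
  refine ⟨a, fun ε hε => ?_⟩
  obtain ⟨K, hKc, hKpos, hKf⟩ : ∃ K, IsCompact K ∧ 0 < torusMeasure K ∧
      ∀ x ∈ K, |f x - a| < ε / 2 := by
    have hnull : NullMeasurableSet (f ⁻¹' Metric.ball a (ε / 2)) torusMeasure :=
      hmeas.nullMeasurableSet_preimage Metric.isOpen_ball.measurableSet
    obtain ⟨T, hTS, hT, hTae⟩ := hnull.exists_measurable_subset_ae_eq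
    have hTpos : 0 < torusMeasure T := by
      rw [measure_congr hTae]; exact ha _ (half_pos hε)
    obtain ⟨K, hKT, hKc, hKpos⟩ := hT.exists_lt_isCompact_of_ne_top (measure_ne_top _ _) hTpos
    exact ⟨K, hKc, hKpos, fun x hx => hTS (hKT hx)⟩
  have hL : 0 < |L| + 1 := by positivity
  obtain ⟨A, b, hA, hd⟩ :=
    exists_subtorus_distInfty_le hKc hKpos (δ := ε / 2 / (|L| + 1)) (by positivity)
  refine ⟨A, b, hA, essSup_le_of_ae_le _ ?_⟩
  filter_upwards [ae_subtorusMeasure A b] with x hx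
  refine ENNReal.ofReal_le_ofReal ?_
  obtain ⟨y, hyK, hxy⟩ := hd x hx
  have h0 : 0 ≤ distInfty x y := Real.iSup_nonneg fun i => dist_nonneg
  have h1 : |f x - f y| ≤ ε / 2 := calc
    |f x - f y| ≤ L * distInfty x y := hlip x y
    _ ≤ (|L| + 1) * distInfty x y := by gcongr; linarith [le_abs_self L]
    _ ≤ (|L| + 1) * (ε / 2 / (|L| + 1)) := by gcongr
    _ = ε / 2 := by field_simp
  linarith [abs_sub_le (f x) (f y) a, hKf y hyK]
end
end

section
/- Let n ≥ 1, let 1 < p < ∞, let 0 < ε < 1/2, and let f : 𝕋ⁿ → ℝ be 1-Lipschitz with respect to the metric dist_p on the n-dimensional torus. Set q = p/(p−1). Assume that ∫_{𝕋ⁿ} ∑_{i=0}^{n−1} (2^{i²+qi} / (ω_{i,p} · ε^{i+q})) · |∂f/∂x_{i+1}|^q ≤ 1, where the partial derivatives exist almost everywhere by Rademacher's theorem and the integral is with respect to the uniform probability measure on 𝕋ⁿ. Then osc(f; 𝕋ⁿ) = sup f − inf f < 8ε. -/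
noncomputable section
open MeasureTheory ENNReal Filter
open scoped Classical

/-- The `n`-dimensional torus `𝕋ⁿ = ℝⁿ/ℤⁿ`; its `volume` (coming from the product of the
Haar probability measures on the circles `ℝ/ℤ`) is the uniform probability measure. -/
abbrev Torus (n : ℕ) : Type := Fin n → AddCircle (1 : ℝ)

/-- The metric `dist_p` on `𝕋ⁿ`: `dist_p(x,y) = (∑ᵢ dist(xᵢ,yᵢ)^p)^(1/p)`. -/
def distPFin {n : ℕ} (p : ℝ) (x y : Torus n) : ℝ :=
  (∑ i, dist (x i) (y i) ^ p) ^ (1 / p)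

/-- The partial derivative `∂f/∂x_i` of `f : 𝕋ⁿ → ℝ` along the `i`-th coordinate circle
at `x` (defined almost everywhere by Rademacher's theorem; junk value `0` elsewhere). -/
def pderivFin {n : ℕ} (f : Torus n → ℝ) (i : Fin n) (x : Torus n) : ℝ :=
  deriv (fun t : ℝ => f (Function.update x i (x i + (t : AddCircle (1 : ℝ))))) 0

/-- `ω_{i,p}`: the `i`-dimensional Lebesgue volume of the unit `ℓ_p`-ball in `ℝⁱ`
(equal to `1` when `i = 0`). -/
def lpBallVolume (i : ℕ) (p : ℝ) : ℝ :=
  (volume {x : Fin i → ℝ | ∑ j, |x j| ^ p ≤ 1}).toReal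

open Set in
/-- A `1`-Lipschitz function on the circle oscillates by at most the `L^q` norm of its derivative. -/
lemma ofReal_abs_sub_rpow_le_lintegral_deriv {g : AddCircle (1 : ℝ) → ℝ}
    (hg : ∀ s t, |g s - g t| ≤ dist s t) {q : ℝ} (hq : 1 < q) (s t : AddCircle (1 : ℝ)) :
    ENNReal.ofReal |g s - g t| ^ q
      ≤ ∫⁻ u, ENNReal.ofReal |deriv (fun r : ℝ => g (u + (r : AddCircle (1 : ℝ)))) 0| ^ q := by
  obtain ⟨a, rfl⟩ := QuotientAddGroup.mk_surjective s
  obtain ⟨b, hb, rfl⟩ : t ∈ ((↑) : ℝ → AddCircle (1 : ℝ)) '' Ico a (a + 1) := by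
    rw [AddCircle.coe_image_Ico_eq]; trivial
  set G : ℝ → ℝ := fun r => g (r : AddCircle (1 : ℝ)) with hG
  have hlip : LipschitzWith 1 G := LipschitzWith.of_dist_le_mul fun x y => by
    rw [NNReal.coe_one, one_mul, Real.dist_eq]
    refine (hg x y).trans ?_
    rw [dist_eq_norm, dist_eq_norm, ← AddCircle.coe_sub]
    exact QuotientAddGroup.norm_mk_le_norm
  have hderiv (u : ℝ) :
      deriv (fun r : ℝ => g ((u : AddCircle (1 : ℝ)) + (r : AddCircle (1 : ℝ)))) 0 = deriv G u := by
    have := deriv_comp_const_add (f := G) u 0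
    simpa [hG] using this
  rw [← AddCircle.lintegral_preimage 1 a]
  simp only [hderiv]
  have hmeas : Measurable fun u => ENNReal.ofReal |deriv G u| :=
    (measurable_norm.comp (measurable_deriv G)).ennreal_ofReal
  have hftc : ∫ x in a..b, deriv G x = G b - G a :=
    (hlip.lipschitzOnWith (s := uIcc a b)).absolutelyContinuousOnInterval.integral_deriv_eq_sub
  have hle : ENNReal.ofReal |g a - g b| ≤ ∫⁻ u in Ioc a (a + 1), ENNReal.ofReal |deriv G u| := by
    calc ENNReal.ofReal |g a - g b| = ‖∫ x in a..b, deriv G x‖ₑ := by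
          rw [hftc, Real.enorm_eq_ofReal_abs, abs_sub_comm]
      _ ≤ ∫⁻ x in Ioc a b, ‖deriv G x‖ₑ := by
          rw [intervalIntegral.integral_of_le hb.1]
          exact enorm_integral_le_lintegral_enorm _
      _ ≤ ∫⁻ x in Ioc a (a + 1), ‖deriv G x‖ₑ :=
          lintegral_mono_set (Ioc_subset_Ioc_right hb.2.le)
      _ = _ := by simp only [Real.enorm_eq_ofReal_abs]
  have hholder := ENNReal.lintegral_mul_le_Lp_mul_Lq (volume.restrict (Ioc a (a + 1)))
    (Real.HolderConjugate.conjExponent hq) hmeas.aemeasurable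
    (aemeasurable_const (b := (1 : ℝ≥0∞)))
  simp only [Pi.mul_apply, mul_one, ENNReal.one_rpow, lintegral_const, Measure.restrict_apply,
    MeasurableSet.univ, univ_inter, Real.volume_Ioc, add_sub_cancel_left, ENNReal.ofReal_one,
    one_div] at hholder
  have hq0 : 0 < q := by linarith
  calc ENNReal.ofReal |g a - g b| ^ q
      ≤ ((∫⁻ u in Ioc a (a + 1), ENNReal.ofReal |deriv G u| ^ q) ^ q⁻¹) ^ q :=
        ENNReal.rpow_le_rpow (hle.trans hholder) hq0.le
    _ = _ := ENNReal.rpow_inv_rpow hq0.ne' _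

lemma distPFin_snoc_left {n : ℕ} {p : ℝ} (hp : 1 < p) (z w : Torus n) (t : AddCircle (1 : ℝ)) :
    distPFin p (Fin.snoc z t : Torus (n + 1)) (Fin.snoc w t) = distPFin p z w := by
  simp [distPFin, Fin.sum_univ_castSucc, Real.zero_rpow (by linarith : p ≠ 0)]

lemma distPFin_snoc_right {n : ℕ} {p : ℝ} (hp : 1 < p) (z : Torus n) (s t : AddCircle (1 : ℝ)) :
    distPFin p (Fin.snoc z s : Torus (n + 1)) (Fin.snoc z t) = dist s t := by
  have hp0 : p ≠ 0 := by linarith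
  simp [distPFin, Fin.sum_univ_castSucc, Real.zero_rpow hp0, Real.rpow_rpow_inv dist_nonneg hp0]

lemma continuous_of_abs_sub_le_distPFin {n : ℕ} {p : ℝ} (hp : 1 < p) {f : Torus n → ℝ}
    (hlip : ∀ x y : Torus n, |f x - f y| ≤ distPFin p x y) : Continuous f := by
  have hp0 : 0 < p := by linarith
  refine continuous_iff_continuousAt.2 fun x => ?_
  refine tendsto_iff_dist_tendsto_zero.2 ?_
  have hcont : Continuous fun y => distPFin p y x := by
    unfold distPFin
    refine Continuous.rpow_const ?_ fun _ => Or.inr (by positivity)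
    exact continuous_finsetSum _ fun i _ =>
      Continuous.rpow_const (by fun_prop) fun _ => Or.inr hp0.le
  have h0 : distPFin p x x = 0 := by
    simp [distPFin, Real.zero_rpow hp0.ne', Real.zero_rpow (inv_ne_zero hp0.ne')]
  exact squeeze_zero (fun _ => dist_nonneg) (fun y => hlip y x) (h0 ▸ hcont.tendsto x)

lemma measurable_pderivFin {n : ℕ} {f : Torus n → ℝ} (hf : Continuous f) (i : Fin n) :
    Measurable (pderivFin f i) := by
  have hc : Continuous (Function.uncurry fun (x : Torus n) (t : ℝ) =>
      f (Function.update x i (x i + (t : AddCircle (1 : ℝ))))) := by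
    refine hf.comp (continuous_fst.update i ?_)
    exact ((continuous_apply i).comp continuous_fst).add
      ((AddCircle.continuous_mk' 1).comp continuous_snd)
  exact (measurable_deriv_with_param hc).comp (measurable_id.prodMk measurable_const)

lemma pderivFin_snoc_castSucc {n : ℕ} (f : Torus (n + 1) → ℝ) (i : Fin n) (z : Torus n)
    (t : AddCircle (1 : ℝ)) :
    pderivFin f i.castSucc (Fin.snoc z t) = pderivFin (fun w => f (Fin.snoc w t)) i z := by
  simp [pderivFin, Fin.snoc_update]

lemma pderivFin_snoc_last {n : ℕ} (f : Torus (n + 1) → ℝ) (z : Torus n)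
    (t : AddCircle (1 : ℝ)) :
    pderivFin f (Fin.last n) (Fin.snoc z t)
      = deriv (fun r : ℝ => f (Fin.snoc z (t + (r : AddCircle (1 : ℝ))))) 0 := by
  have (r : ℝ) : (Function.update (Fin.snoc z t : Torus (n + 1)) (Fin.last n)
      (t + (r : AddCircle (1 : ℝ)))) = Fin.snoc z (t + (r : AddCircle (1 : ℝ))) :=
    Fin.update_snoc_last (α := fun _ => AddCircle (1 : ℝ)) _ _ _
  simp [pderivFin, this]

instance : IsProbabilityMeasure (volume : Measure (AddCircle (1 : ℝ))) :=
  ⟨by simp [AddCircle.measure_univ]⟩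

lemma measurePreserving_snoc (n : ℕ) :
    MeasurePreserving (fun x : AddCircle (1 : ℝ) × Torus n => (Fin.snoc x.2 x.1 : Torus (n + 1))) := by
  convert (volume_preserving_piFinSuccAbove (fun _ : Fin (n + 1) => AddCircle (1 : ℝ))
    (Fin.last n)).symm using 1
  ext x : 1
  simp [MeasurableEquiv.piFinSuccAbove, Fin.insertNthEquiv]

/-- Tonelli's theorem on the torus, splitting off the last coordinate. -/
lemma lintegral_torus_succ {n : ℕ} {F : Torus (n + 1) → ℝ≥0∞} (hF : Measurable F) :
    ∫⁻ x, F x = ∫⁻ t : AddCircle (1 : ℝ), ∫⁻ z : Torus n, F (Fin.snoc z t) := by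
  have hm := measurePreserving_snoc n
  rw [← hm.lintegral_comp hF]
  exact lintegral_prod _ (hF.comp hm.measurable).aemeasurable

lemma lintegral_torus_succ_symm {n : ℕ} {F : Torus (n + 1) → ℝ≥0∞} (hF : Measurable F) :
    ∫⁻ x, F x = ∫⁻ z : Torus n, ∫⁻ t : AddCircle (1 : ℝ), F (Fin.snoc z t) := by
  have hm := measurePreserving_snoc n
  rw [← hm.lintegral_comp hF]
  exact lintegral_prod_symm _ (hF.comp hm.measurable).aemeasurable

lemma abs_le_of_sum_abs_rpow_le {ι : Type*} [Fintype ι] {p r : ℝ} (hp : 1 < p) (hr : 0 ≤ r)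
    {x : ι → ℝ} (hx : ∑ j, |x j| ^ p ≤ r ^ p) (j : ι) : |x j| ≤ r := by
  have h : |x j| ^ p ≤ ∑ j, |x j| ^ p :=
    Finset.single_le_sum (f := fun j => |x j| ^ p) (fun _ _ => by positivity) (Finset.mem_univ j)
  exact (Real.rpow_le_rpow_iff (abs_nonneg _) hr (by linarith)).1 (h.trans hx)

lemma continuous_sum_abs_rpow (n : ℕ) {p : ℝ} (hp : 1 < p) :
    Continuous fun x : Fin n → ℝ => ∑ j, |x j| ^ p :=
  continuous_finsetSum _ fun i _ =>
    Continuous.rpow_const (by fun_prop) fun _ => Or.inr (by linarith)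

lemma volume_lpBall_ne_top (n : ℕ) {p : ℝ} (hp : 1 < p) :
    volume {x : Fin n → ℝ | ∑ j, |x j| ^ p ≤ 1} ≠ ∞ := by
  refine ((measure_mono ?_).trans_lt
    (measure_Icc_lt_top (a := fun _ : Fin n => (-1 : ℝ)) (b := fun _ => 1))).ne
  intro x hx
  have h := abs_le_of_sum_abs_rpow_le hp zero_le_one (x := x) (by simpa using hx)
  exact ⟨fun j => (abs_le.1 (h j)).1, fun j => (abs_le.1 (h j)).2⟩

lemma lpBallVolume_pos (n : ℕ) {p : ℝ} (hp : 1 < p) : 0 < lpBallVolume n p := by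
  refine ENNReal.toReal_pos ?_ (volume_lpBall_ne_top n hp)
  have hopen : IsOpen {x : Fin n → ℝ | ∑ j, |x j| ^ p < 1} :=
    isOpen_lt (continuous_sum_abs_rpow n hp) continuous_const
  have hpos := hopen.measure_pos volume
    ⟨0, by simp [Real.zero_rpow (by linarith : p ≠ 0)]⟩
  exact (hpos.trans_le (measure_mono fun x (hx : ∑ j, |x j| ^ p < 1) => hx.le)).ne'

open scoped Pointwise in
lemma volume_lpBall (n : ℕ) {p r : ℝ} (hp : 1 < p) (hr : 0 < r) (a : Fin n → ℝ) :
    volume {x : Fin n → ℝ | ∑ j, |x j - a j| ^ p ≤ r ^ p}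
      = ENNReal.ofReal (lpBallVolume n p * r ^ n) := by
  have hset : {x : Fin n → ℝ | ∑ j, |x j - a j| ^ p ≤ r ^ p}
      = (fun x => x - a) ⁻¹' (r • {x : Fin n → ℝ | ∑ j, |x j| ^ p ≤ 1}) := by
    ext x
    rw [Set.mem_preimage, Set.mem_smul_set_iff_inv_smul_mem₀ hr.ne']
    have h : ∑ j, |(r⁻¹ • (x - a)) j| ^ p = (∑ j, |x j - a j| ^ p) / r ^ p := by
      rw [Finset.sum_div]
      refine Finset.sum_congr rfl fun j _ => ?_
      rw [← Real.div_rpow (abs_nonneg _) hr.le]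
      simp [abs_mul, abs_of_pos hr, div_eq_inv_mul]
    rw [Set.mem_ofPred_eq, Set.mem_ofPred_eq, h, div_le_one (by positivity)]
  simp only [sub_eq_add_neg] at hset ⊢
  rw [hset, measure_preimage_add_right, Measure.addHaar_smul_of_nonneg _ hr.le, lpBallVolume,
    Module.finrank_fin_fun, mul_comm, ENNReal.ofReal_mul ENNReal.toReal_nonneg,
    ENNReal.ofReal_toReal (volume_lpBall_ne_top n hp)]

/-- In each `dist_p`-ball of radius `r < 1/2`, some value of `F` is at most its mean. -/
lemma exists_distPFin_le_mul_le_lintegral {n : ℕ} {p r : ℝ} (hp : 1 < p) (hr : 0 < r)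
    (hr2 : r < 1 / 2) {F : Torus n → ℝ≥0∞} (hF : Measurable F) (z : Torus n) :
    ∃ w, distPFin p z w ≤ r ∧
      ENNReal.ofReal (lpBallVolume n p * r ^ n) * F w ≤ ∫⁻ x, F x := by
  choose a ha using fun j => QuotientAddGroup.mk_surjective (z j)
  set B := {x : Fin n → ℝ | ∑ j, |x j - a j| ^ p ≤ r ^ p}
  set Q : Set (Fin n → ℝ) :=
    Set.univ.pi fun j => Set.Ioc (a j - 1 / 2) (a j - 1 / 2 + 1) with hQ
  have hBQ : B ⊆ Q := fun x hx j _ => by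
    have h := abs_le.1 (abs_le_of_sum_abs_rpow_le hp hr.le (x := fun j => x j - a j) hx j)
    constructor <;> linarith [h.1, h.2]
  have hvol := volume_lpBall n hp hr a
  have hπ : MeasurePreserving (fun (x : Fin n → ℝ) j => (x j : AddCircle (1 : ℝ)))
      (volume.restrict Q) volume := by
    rw [hQ, volume_pi, Measure.restrict_pi_pi]
    exact measurePreserving_pi _ _ fun j => AddCircle.measurePreserving_mk 1 _
  have hFπ : Measurable fun x : Fin n → ℝ => F fun j => (x j : AddCircle (1 : ℝ)) :=
    hF.comp hπ.measurable
  have hpos : 0 < lpBallVolume n p * r ^ n := mul_pos (lpBallVolume_pos n hp) (by positivity)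
  have hB0 : volume B ≠ 0 := by rw [hvol]; simpa using hpos
  have hBtop : volume B ≠ ∞ := by rw [hvol]; exact ENNReal.ofReal_ne_top
  obtain ⟨y, hy, hyF⟩ := exists_le_setLAverage hB0 hBtop hFπ.aemeasurable
  refine ⟨fun j => y j, ?_, ?_⟩
  · rw [distPFin, one_div]
    have hle : ∑ j, dist (z j) (y j : AddCircle (1 : ℝ)) ^ p ≤ r ^ p := by
      refine (Finset.sum_le_sum fun j _ => ?_).trans hy
      refine Real.rpow_le_rpow dist_nonneg ?_ (by linarith)
      rw [← ha j, dist_comm, dist_eq_norm]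
      exact QuotientAddGroup.norm_mk_le_norm
    have h := Real.rpow_le_rpow (by positivity) hle (by positivity : 0 ≤ p⁻¹)
    rwa [Real.rpow_rpow_inv hr.le (by linarith)] at h
  · rw [← hvol]
    calc volume B * F (fun j => y j)
        ≤ volume B * ⨍⁻ x in B, F (fun j => (x j : AddCircle (1 : ℝ))) ∂volume := by gcongr
      _ = ∫⁻ x in B, F (fun j => (x j : AddCircle (1 : ℝ))) := by
          exact measure_mul_setLAverage _ hBtop
      _ ≤ ∫⁻ x in Q, F (fun j => (x j : AddCircle (1 : ℝ))) := lintegral_mono_set hBQ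
      _ = ∫⁻ x, F x := hπ.lintegral_comp hF

lemma weight_mul_ball_eq {n : ℕ} {p q ε : ℝ} (hp : 1 < p) (hε : 0 < ε) :
    (2 : ℝ) ^ ((n : ℝ) ^ 2 + q * n) / (lpBallVolume n p * ε ^ ((n : ℝ) + q))
      * (lpBallVolume n p * (ε / 2 ^ n) ^ n) = ((ε / 2 ^ n) ^ q)⁻¹ := by
  have hω := (lpBallVolume_pos n hp).ne'
  have h2 : (2 : ℝ) ^ ((n : ℝ) ^ 2 + q * n) = (2 ^ n) ^ n * (2 ^ n) ^ q := by
    rw [Real.rpow_add two_pos, mul_comm q, Real.rpow_mul two_pos.le, sq,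
      Real.rpow_mul two_pos.le, Real.rpow_natCast, Real.rpow_natCast]
  rw [h2, Real.rpow_add hε, Real.rpow_natCast, Real.div_rpow hε.le (by positivity), div_pow]
  field_simp

/-- Near every fibre in the last coordinate there is one along which `f` oscillates little. -/
lemma exists_fibre_abs_sub_le {n : ℕ} {p q ε : ℝ} (hp : 1 < p) (hq : 1 < q) (hε0 : 0 < ε)
    (hε : ε < 1 / 2) {f : Torus (n + 1) → ℝ} (hlip : ∀ x y, |f x - f y| ≤ distPFin p x y)
    (hint : ∫⁻ x, ∑ i : Fin (n + 1),
        ENNReal.ofReal ((2 : ℝ) ^ ((i.1 : ℝ) ^ 2 + q * i.1) / (lpBallVolume i.1 p * ε ^ ((i.1 : ℝ) + q)))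
          * ENNReal.ofReal |pderivFin f i x| ^ q ≤ 1) (z : Torus n) :
    ∃ w, distPFin p z w ≤ ε / 2 ^ n ∧
      ∀ s t, |f (Fin.snoc w s) - f (Fin.snoc w t)| ≤ ε / 2 ^ n := by
  set c := (2 : ℝ) ^ ((n : ℝ) ^ 2 + q * n) / (lpBallVolume n p * ε ^ ((n : ℝ) + q)) with hc
  have hω := lpBallVolume_pos n hp
  have hc0 : 0 ≤ c := by positivity
  set r := ε / 2 ^ n with hr
  have hr0 : 0 < r := by positivity
  have hr2 : r < 1 / 2 := (div_le_self hε0.le (one_le_pow₀ one_le_two)).trans_lt hε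
  have hmeas : Measurable fun x => ENNReal.ofReal |pderivFin f (Fin.last n) x| ^ q :=
    (measurable_norm.comp (measurable_pderivFin
      (continuous_of_abs_sub_le_distPFin hp hlip) _)).ennreal_ofReal.pow_const q
  have hmeas2 : Measurable fun w : Torus n => ∫⁻ t : AddCircle (1 : ℝ),
      ENNReal.ofReal |pderivFin f (Fin.last n) (Fin.snoc w t)| ^ q :=
    (hmeas.comp (measurePreserving_snoc n).measurable).lintegral_prod_left'
  replace hint : ∫⁻ x, ENNReal.ofReal c * ENNReal.ofReal |pderivFin f (Fin.last n) x| ^ q ≤ 1 := by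
    refine le_trans (lintegral_mono fun x => ?_) hint
    rw [Fin.sum_univ_castSucc]
    exact le_add_self
  rw [lintegral_const_mul _ hmeas, lintegral_torus_succ_symm hmeas] at hint
  obtain ⟨w, hzw, hw⟩ := exists_distPFin_le_mul_le_lintegral hp hr0 hr2 hmeas2 z
  refine ⟨w, hzw, fun s t => ?_⟩
  have hosc := ofReal_abs_sub_rpow_le_lintegral_deriv (g := fun t => f (Fin.snoc w t))
    (fun s t => (hlip _ _).trans_eq (distPFin_snoc_right hp w s t)) hq s t
  simp only [← pderivFin_snoc_last] at hosc
  set D := |f (Fin.snoc w s) - f (Fin.snoc w t)|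
  have hD0 : 0 ≤ D := abs_nonneg _
  have h : ENNReal.ofReal (c * (lpBallVolume n p * r ^ n) * D ^ q) ≤ 1 := by
    rw [ENNReal.ofReal_mul (by positivity), ENNReal.ofReal_mul hc0, mul_assoc,
      ← ENNReal.ofReal_rpow_of_nonneg hD0 (by linarith)]
    refine le_trans ?_ hint
    gcongr
    exact le_trans (by gcongr) hw
  rw [ENNReal.ofReal_le_one, hc, hr, weight_mul_ball_eq hp hε0, ← hr,
    inv_mul_le_one₀ (by positivity)] at h
  exact (Real.rpow_le_rpow_iff hD0 hr0.le (by linarith)).1 h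

lemma abs_sub_le_of_morrey_integral_le {p q ε : ℝ} (hp : 1 < p) (hq : 1 < q) (hε0 : 0 < ε)
    (hε : ε < 1 / 2) (n : ℕ) (f : Torus (n + 1) → ℝ)
    (hlip : ∀ x y, |f x - f y| ≤ distPFin p x y)
    (hint : ∫⁻ x, ∑ i : Fin (n + 1),
        ENNReal.ofReal ((2 : ℝ) ^ ((i.1 : ℝ) ^ 2 + q * i.1) / (lpBallVolume i.1 p * ε ^ ((i.1 : ℝ) + q)))
          * ENNReal.ofReal |pderivFin f i x| ^ q ≤ 1) (x y : Torus (n + 1)) :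
    |f x - f y| ≤ 7 * ε - 6 * (ε / 2 ^ n) := by
  have hsnoc {m : ℕ} (x : Torus (m + 1)) : ∃ (z : Torus m) (t : _), x = Fin.snoc z t :=
    ⟨_, _, (Fin.snoc_init_self x).symm⟩
  induction n with
  | zero =>
    obtain ⟨z, s, rfl⟩ := hsnoc x
    obtain ⟨z', s', rfl⟩ := hsnoc y
    obtain ⟨w, -, hw⟩ := exists_fibre_abs_sub_le hp hq hε0 hε hlip hint z
    rw [Subsingleton.elim z w, Subsingleton.elim z' w]
    refine (hw s s').trans ?_
    rw [pow_zero, div_one]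
    linarith
  | succ n ih =>
    obtain ⟨z, s, rfl⟩ := hsnoc x
    obtain ⟨z', s', rfl⟩ := hsnoc y
    have hfib (z : Torus (n + 1)) (s t : AddCircle (1 : ℝ)) :
        |f (Fin.snoc z s) - f (Fin.snoc z t)| ≤ 3 * (ε / 2 ^ (n + 1)) := by
      obtain ⟨w, hzw, hw⟩ := exists_fibre_abs_sub_le hp hq hε0 hε hlip hint z
      have h1 := (hlip (Fin.snoc z s) (Fin.snoc w s)).trans_eq (distPFin_snoc_left hp z w s)
      have h2 := (hlip (Fin.snoc z t) (Fin.snoc w t)).trans_eq (distPFin_snoc_left hp z w t)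
      have h3 := hw s t
      rw [abs_le] at h1 h2 h3 ⊢
      constructor <;> linarith [h1.1, h1.2, h2.1, h2.2, h3.1, h3.2]
    have hcont := continuous_of_abs_sub_le_distPFin hp hlip
    have hterm (i : Fin (n + 2)) :
        Measurable fun x => ENNReal.ofReal |pderivFin f i x| ^ q :=
      (measurable_norm.comp (measurable_pderivFin hcont i)).ennreal_ofReal.pow_const q
    have hF := Finset.measurable_fun_sum Finset.univ fun i _ => (hterm i).const_mul
      (ENNReal.ofReal ((2 : ℝ) ^ ((i.1 : ℝ) ^ 2 + q * i.1)
        / (lpBallVolume i.1 p * ε ^ ((i.1 : ℝ) + q))))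
    rw [lintegral_torus_succ hF] at hint
    obtain ⟨t, ht⟩ := exists_le_lintegral (μ := (volume : Measure (AddCircle (1 : ℝ))))
      (Measurable.lintegral_prod_right' (ν := (volume : Measure (Torus (n + 1))))
        (hF.comp (measurePreserving_snoc (n + 1)).measurable)).aemeasurable
    have hslice := ih (fun w => f (Fin.snoc w t))
      (fun x y => (hlip _ _).trans_eq (distPFin_snoc_left hp x y t)) (by
        refine le_trans (lintegral_mono fun w => ?_) (ht.trans hint)
        simp only [Function.comp_apply]
        rw [Fin.sum_univ_castSucc (n := n + 1)]
        simp only [pderivFin_snoc_castSucc, Fin.val_castSucc]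
        exact le_self_add) z z'
    have h1 := hfib z s t
    have h2 := hfib z' s' t
    have hpow : ε / 2 ^ n = 2 * (ε / 2 ^ (n + 1)) := by rw [pow_succ]; field_simp
    rw [hpow] at hslice
    rw [abs_le] at h1 h2 hslice ⊢
    constructor <;> linarith [h1.1, h1.2, h2.1, h2.2, hslice.1, hslice.2]

/-- variant of Morrey's inequality. Let `n ≥ 1`, `1 < p < ∞`,
`0 < ε < 1/2`, `q = p/(p-1)`, and let `f : 𝕋ⁿ → ℝ` be `1`-Lipschitz w.r.t. `dist_p`. If
`∫ ∑_{i=0}^{n-1} 2^(i²+qi)/(ω_{i,p} ε^(i+q)) |∂f/∂x_{i+1}|^q ≤ 1` (integration w.r.t. the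
uniform probability measure), then `osc(f;𝕋ⁿ) = sup f - inf f < 8ε`. (Coordinates are
`0`-indexed: Lean's coordinate `i` is the paper's coordinate `i+1`.) -/
theorem morrey_torus_dist_p (n : ℕ) (hn : 1 ≤ n) (p q ε : ℝ) (hp : 1 < p)
    (hq : q = p / (p - 1)) (hε0 : 0 < ε) (hε : ε < 1 / 2) (f : Torus n → ℝ)
    (hlip : ∀ x y : Torus n, |f x - f y| ≤ distPFin p x y)
    (hint : ∫⁻ x : Torus n, ∑ i : Fin n,
        ENNReal.ofReal ((2 : ℝ) ^ ((i.1 : ℝ) ^ 2 + q * i.1) / (lpBallVolume i.1 p * ε ^ ((i.1 : ℝ) + q)))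
          * ENNReal.ofReal |pderivFin f i x| ^ q ≤ 1) :
    (⨆ x, f x) - (⨅ x, f x) < 8 * ε := by
  obtain ⟨n, rfl⟩ : ∃ m, n = m + 1 := ⟨n - 1, by omega⟩
  have hq1 : 1 < q := by
    rw [hq, lt_div_iff₀ (by linarith)]
    linarith
  have hosc (x y : Torus (n + 1)) : f x ≤ f y + 7 * ε := by
    have h := abs_le.1 (abs_sub_le_of_morrey_integral_le hp hq1 hε0 hε n f hlip hint x y)
    have : 0 < ε / 2 ^ n := by positivity
    linarith [h.2]
  have h : (⨆ x, f x) ≤ (⨅ y, f y) + 7 * ε :=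
    ciSup_le fun x => sub_le_iff_le_add.1 <| le_ciInf fun y => sub_le_iff_le_add.2 (hosc x y)
  linarith
end
end
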